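/- arXiv:2011.07695 — 3 statements merged into one kernel-verified Lean document; each statement's English description precedes it below -/
import Mathlib

section
/- Let 0 ≤ k ≤ n be integers. The Schubert cochain complex over ℤ is isomorphic, as a cochain complex of abelian groups, to the direct sum of: (i) for each S ∈ {n;k} with In(S) = ∅ and Out(S) = ∅, a copy of ℤ concentrated in cohomological degree d(S); and (ii) for each S ∈ {n;k}_Min, a copy of the two-term complex ℤ →2→ ℤ occupying cohomological degrees d(S) − 1 and d(S). -/
open scoped BigOperators Classical

/-- `{n;k}`: the set of subsets of `{1,…,n}` of cardinality `k`. -/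
def Sset (n k : ℕ) : Finset (Finset ℕ) := (Finset.Icc 1 n).powersetCard k

/-- `elt S r` is `s_r`, the `r`-th smallest element of `S` (1-indexed); junk value `0` out of range. -/
def elt (S : Finset ℕ) (r : ℕ) : ℕ := (S.sort (· ≤ ·)).getD (r - 1) 0

/-- `s_{r+1}`, with the convention `s_{k+1} = n+1`. -/
def nxt (n : ℕ) (S : Finset ℕ) (r : ℕ) : ℕ := if r = S.card then n + 1 else elt S (r + 1)

/-- `s_{r-1}`, with the convention `s_0 = 0`. -/
def prv (S : Finset ℕ) (r : ℕ) : ℕ := if r = 1 then 0 else elt S (r - 1)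

/-- `d_r(S) = Σ_{r ≤ i ≤ k} (s_i − i)`. -/
def dr (S : Finset ℕ) (r : ℕ) : ℕ := ∑ i ∈ Finset.Icc r S.card, (elt S i - i)

/-- `d(S) = d_1(S)`. -/
def dS (S : Finset ℕ) : ℕ := dr S 1

/-- `S_r`: the set obtained from `S` by replacing `s_r` with `s_r + 1`. -/
def Sr (S : Finset ℕ) (r : ℕ) : Finset ℕ := insert (elt S r + 1) (S.erase (elt S r))

/-- `In(S) = {i ∈ {1,…,k} : s_i ≡ k (mod 2) and s_{i−1} < s_i − 1}` (convention `s_0 = 0`). -/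
def InS (k : ℕ) (S : Finset ℕ) : Finset ℕ :=
  (Finset.Icc 1 k).filter fun i => elt S i % 2 = k % 2 ∧ prv S i + 1 < elt S i

/-- `Out(S) = {i ∈ {1,…,k} : s_i ≢ k (mod 2) and s_i + 1 < s_{i+1}}` (convention `s_{k+1} = n+1`). -/
def OutS (n k : ℕ) (S : Finset ℕ) : Finset ℕ :=
  (Finset.Icc 1 k).filter fun i => ¬ (elt S i % 2 = k % 2) ∧ elt S i + 1 < nxt n S i

/-- The coefficient of `T` in the Schubert differential `δ(S)`. -/
noncomputable def schubCoeff (n k : ℕ) (R : Type*) [CommRing R] (T S : Finset ℕ) : R :=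
  ∑ r ∈ Finset.Icc 1 k,
    if 1 < nxt n S r - elt S r ∧ Odd ((k : ℤ) - elt S r) ∧ T = Sr S r
    then (-1 : R) ^ dr S r * 2 else 0

/-- The matrix of the Schubert differential on the basis `{n;k}`. -/
noncomputable def schubD (n k : ℕ) (R : Type*) [CommRing R] :
    Matrix ↥(Sset n k) ↥(Sset n k) R :=
  fun T S => schubCoeff n k R T.1 S.1

/-- An isomorphism of (co)chain complexes, where a complex is presented by a finite basis `ι`,
a degree function `deg : ι → ℤ`, and the matrix `D` of its differential: an `R`-linear
equivalence commuting with the differentials and preserving the grading. -/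
def CxIso {ι κ : Type*} [Fintype ι] [Fintype κ] (R : Type*) [CommRing R]
    (D₁ : Matrix ι ι R) (deg₁ : ι → ℤ) (D₂ : Matrix κ κ R) (deg₂ : κ → ℤ) : Prop :=
  ∃ e : (ι → R) ≃ₗ[R] (κ → R),
    (∀ v, e (D₁.mulVec v) = D₂.mulVec (e v)) ∧
    (∀ (m : ℤ) (v : ι → R), (∀ i, deg₁ i ≠ m → v i = 0) → ∀ j, deg₂ j ≠ m → e v j = 0) ∧
    (∀ (m : ℤ) (w : κ → R), (∀ j, deg₂ j ≠ m → w j = 0) → ∀ i, deg₁ i ≠ m → e.symm w i = 0)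

/-- The elements of `{n;k}` with `In(S) = ∅ = Out(S)`. -/
noncomputable def freeIdx (n k : ℕ) : Finset (Finset ℕ) :=
  (Sset n k).filter fun S => InS k S = ∅ ∧ OutS n k S = ∅

/-- `{n;k}_Min`: the elements with `In(S) ∪ Out(S) ≠ ∅` and `min (In(S) ∪ Out(S)) ∈ In(S)`. -/
noncomputable def minIdx (n k : ℕ) : Finset (Finset ℕ) :=
  (Sset n k).filter fun S => ∃ i ∈ InS k S, ∀ j ∈ InS k S ∪ OutS n k S, i ≤ j

/-- The differential of
`(⊕_{In(S) = ∅ = Out(S)} ℤ[d(S)]) ⊕ (⊕_{S ∈ {n;k}_Min} Cone(ℤ →2→ ℤ)[d(S)−1])`: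
it is zero on the first summand, and on the copy of the two-term complex indexed by
`S ∈ {n;k}_Min` it is multiplication by `2` from the generator in degree `d(S) − 1`
(labelled `0`) to the generator in degree `d(S)` (labelled `1`). -/
noncomputable def coneSumD (n k : ℕ) :
    Matrix (↥(freeIdx n k) ⊕ ↥(minIdx n k) × Fin 2)
      (↥(freeIdx n k) ⊕ ↥(minIdx n k) × Fin 2) ℤ :=
  fun x y =>
    match x, y with
    | .inr (S, i), .inr (T, j) => if S = T ∧ i = 1 ∧ j = 0 then 2 else 0
    | _, _ => 0

namespace Schub

lemma elt_eq {n k : ℕ} {S : Finset ℕ} (hS : S ∈ Sset n k) {r : ℕ} (h1 : 1 ≤ r) (h2 : r ≤ k) :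
    elt S r = S.orderEmbOfFin (Finset.mem_powersetCard.1 hS).2 ⟨r - 1, by omega⟩ := by
  have hc := (Finset.mem_powersetCard.1 hS).2
  rw [Finset.orderEmbOfFin_apply, elt, List.getD_eq_getElem]
  rfl

lemma card_eq {n k : ℕ} {S : Finset ℕ} (hS : S ∈ Sset n k) : S.card = k :=
  (Finset.mem_powersetCard.1 hS).2

lemma elt_mem {n k : ℕ} {S : Finset ℕ} (hS : S ∈ Sset n k) {r : ℕ} (h1 : 1 ≤ r) (h2 : r ≤ k) :
    elt S r ∈ S := by
  rw [elt_eq hS h1 h2]; exact Finset.orderEmbOfFin_mem _ _ _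

lemma elt_bd {n k : ℕ} {S : Finset ℕ} (hS : S ∈ Sset n k) {r : ℕ} (h1 : 1 ≤ r) (h2 : r ≤ k) :
    1 ≤ elt S r ∧ elt S r ≤ n := by
  have := (Finset.mem_powersetCard.1 hS).1 (elt_mem hS h1 h2)
  simpa using this

lemma elt_lt {n k : ℕ} {S : Finset ℕ} (hS : S ∈ Sset n k) {i j : ℕ} (h1 : 1 ≤ i) (h : i < j)
    (h2 : j ≤ k) : elt S i < elt S j := by
  rw [elt_eq hS h1 (by omega), elt_eq hS (by omega) h2]
  apply (Finset.orderEmbOfFin S (card_eq hS)).strictMono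
  simp only [Fin.mk_lt_mk]; omega

lemma elt_ge {n k : ℕ} {S : Finset ℕ} (hS : S ∈ Sset n k) : ∀ {i : ℕ}, i ≤ k → i ≤ elt S i := by
  intro i
  induction i with
  | zero => intro _; omega
  | succ i ih =>
    intro h
    rcases Nat.eq_zero_or_pos i with h0 | h0
    · subst h0; exact (elt_bd hS le_rfl h).1
    · have := ih (by omega)
      have : elt S i < elt S (i + 1) := elt_lt hS h0 (Nat.lt_succ_self i) h
      omega

lemma mem_iff {n k : ℕ} {S : Finset ℕ} (hS : S ∈ Sset n k) (x : ℕ) :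
    x ∈ S ↔ ∃ r, 1 ≤ r ∧ r ≤ k ∧ elt S r = x := by
  constructor
  · intro hx
    have : x ∈ Set.range (S.orderEmbOfFin (card_eq hS)) := by
      rw [Finset.range_orderEmbOfFin]; exact hx
    obtain ⟨i, rfl⟩ := this
    refine ⟨i + 1, by omega, by omega, ?_⟩
    rw [elt_eq hS (by omega) (by omega)]
    rfl
  · rintro ⟨r, h1, h2, rfl⟩; exact elt_mem hS h1 h2

lemma ext_elt {n k : ℕ} {S T : Finset ℕ} (hS : S ∈ Sset n k) (hT : T ∈ Sset n k)
    (h : ∀ r, 1 ≤ r → r ≤ k → elt S r = elt T r) : S = T := by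
  ext x
  rw [mem_iff hS, mem_iff hT]
  constructor <;> rintro ⟨r, h1, h2, h3⟩ <;> refine ⟨r, h1, h2, ?_⟩ <;> rw [← h3, h r h1 h2]

lemma exists_set {n k : ℕ} (s : ℕ → ℕ) (hb : ∀ j, 1 ≤ j → j ≤ k → 1 ≤ s j ∧ s j ≤ n)
    (hm : ∀ i j, 1 ≤ i → i < j → j ≤ k → s i < s j) :
    ∃ S ∈ Sset n k, ∀ j, 1 ≤ j → j ≤ k → elt S j = s j := by
  have hinj : Set.InjOn s (Finset.Icc 1 k : Finset ℕ) := by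
    intro a ha b hb' hab
    simp only [Finset.coe_Icc, Set.mem_Icc] at ha hb'
    rcases lt_trichotomy a b with h | h | h
    · have := hm a b ha.1 h hb'.2; omega
    · exact h
    · have := hm b a hb'.1 h ha.2; omega
  have hS : (Finset.Icc 1 k).image s ∈ Sset n k := by
    refine Finset.mem_powersetCard.2 ⟨?_, ?_⟩
    · intro x hx
      simp only [Finset.mem_image, Finset.mem_Icc] at hx ⊢
      obtain ⟨j, hj, rfl⟩ := hx
      exact hb j hj.1 hj.2
    · rw [Finset.card_image_of_injOn hinj]; simp
  refine ⟨_, hS, ?_⟩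
  intro j h1 h2
  rw [elt_eq hS h1 h2]
  have := Finset.orderEmbOfFin_unique (card_eq hS) (f := fun i : Fin k => s (i + 1))
    (fun i => Finset.mem_image.2 ⟨i + 1, by simp only [Finset.mem_Icc]; omega, rfl⟩)
    (fun a b hab => hm _ _ (by omega) (by simpa using hab) (by omega))
  rw [← this]
  simp only
  congr 1; omega

lemma mem_Out {n k : ℕ} {S : Finset ℕ} (hS : S ∈ Sset n k) (j : ℕ) :
    j ∈ OutS n k S ↔ 1 ≤ j ∧ j ≤ k ∧ elt S j % 2 ≠ k % 2 ∧
      (j = k → elt S j < n) ∧ (j < k → elt S j + 1 < elt S (j + 1)) := by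
  rw [OutS, Finset.mem_filter, Finset.mem_Icc, nxt, card_eq hS]
  by_cases h : j = k
  · subst h; simp; try tauto
  · simp only [h, if_false]
    constructor
    · rintro ⟨⟨a, b⟩, c, d⟩
      exact ⟨a, b, c, fun h => h.elim, fun _ => d⟩
    · rintro ⟨a, b, c, -, d⟩
      exact ⟨⟨a, b⟩, c, d (by omega)⟩

lemma mem_In {k : ℕ} {S : Finset ℕ} (j : ℕ) :
    j ∈ InS k S ↔ 1 ≤ j ∧ j ≤ k ∧ elt S j % 2 = k % 2 ∧
      (j = 1 → 1 < elt S j) ∧ (1 < j → elt S (j - 1) + 1 < elt S j) := by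
  rw [InS, Finset.mem_filter, Finset.mem_Icc, prv]
  by_cases h : j = 1
  · subst h; simp; try tauto
  · simp only [h, if_false]
    constructor
    · rintro ⟨⟨a, b⟩, c, d⟩
      exact ⟨a, b, c, fun h => h.elim, fun _ => d⟩
    · rintro ⟨a, b, c, -, d⟩
      exact ⟨⟨a, b⟩, c, d (by omega)⟩

/-- Basic facts about `S_r`. -/
lemma Sr_spec {n k : ℕ} {S : Finset ℕ} (hS : S ∈ Sset n k) {r : ℕ} (hr : r ∈ OutS n k S) :
    Sr S r ∈ Sset n k ∧
      ∀ j, 1 ≤ j → j ≤ k → elt (Sr S r) j = if j = r then elt S r + 1 else elt S j := by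
  obtain ⟨h1, h2, h3, h4, h5⟩ := (mem_Out hS r).1 hr
  obtain ⟨T, hT, hTe⟩ := exists_set (n := n) (k := k)
    (fun j => if j = r then elt S r + 1 else elt S j) (by
      intro j a b
      have := elt_bd hS a b
      split_ifs with h
      · subst h
        refine ⟨by omega, ?_⟩
        rcases Nat.lt_or_ge j k with h | h
        · have := h5 h
          have := elt_bd hS (r := j + 1) (by omega) (by omega)
          omega
        · have := h4 (by omega)
          omega
      · exact this) (by
      intro i j a b c
      have := elt_lt hS a b c
      split_ifs with h h' h'
      · omega
      · subst h
        have := h5 (by omega)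
        rcases Nat.lt_or_ge (i + 1) j with h | h
        · have := elt_lt hS (i := i + 1) (by omega) h c
          omega
        · have : j = i + 1 := by omega
          subst this; omega
      · subst h'; omega
      · exact this)
  have : Sr S r = T := by
    ext x
    rw [mem_iff hT]
    simp only [Sr, Finset.mem_insert, Finset.mem_erase]
    rw [mem_iff hS]
    constructor
    · rintro (rfl | ⟨hx, j, a, b, rfl⟩)
      · exact ⟨r, h1, h2, by simp [hTe r h1 h2]⟩
      · refine ⟨j, a, b, ?_⟩
        rw [hTe j a b, if_neg]
        rintro rfl; exact hx rfl
    · rintro ⟨j, a, b, rfl⟩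
      rw [hTe j a b]
      split_ifs with h
      · exact Or.inl rfl
      · refine Or.inr ⟨?_, j, a, b, rfl⟩
        rcases lt_trichotomy j r with h' | h' | h'
        · have := elt_lt hS a h' h2; omega
        · exact (h h').elim
        · have := elt_lt hS h1 h' b; omega
  rw [this]
  exact ⟨hT, hTe⟩

lemma Sr_mem {n k : ℕ} {S : Finset ℕ} (hS : S ∈ Sset n k) {r : ℕ} (hr : r ∈ OutS n k S) :
    Sr S r ∈ Sset n k := (Sr_spec hS hr).1

lemma Sr_elt {n k : ℕ} {S : Finset ℕ} (hS : S ∈ Sset n k) {r : ℕ} (hr : r ∈ OutS n k S)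
    {j : ℕ} (h1 : 1 ≤ j) (h2 : j ≤ k) :
    elt (Sr S r) j = if j = r then elt S r + 1 else elt S j := (Sr_spec hS hr).2 j h1 h2

lemma Out_Sr {n k : ℕ} {S : Finset ℕ} (hS : S ∈ Sset n k) {r : ℕ} (hr : r ∈ OutS n k S) (j : ℕ) :
    j ∈ OutS n k (Sr S r) ↔ j ∈ OutS n k S ∧ j ≠ r := by
  rw [mem_Out (Sr_mem hS hr), mem_Out hS]
  obtain ⟨h1, h2, h3, h4, h5⟩ := (mem_Out hS r).1 hr
  by_cases hj : 1 ≤ j ∧ j ≤ k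
  swap
  · tauto
  obtain ⟨a, b⟩ := hj
  rw [Sr_elt hS hr a b]
  by_cases hjr : j = r
  · subst hjr
    simp only [if_true]
    constructor
    · rintro ⟨_, _, h, _⟩; omega
    · rintro ⟨_, h⟩; exact (h rfl).elim
  · simp only [if_neg hjr]
    by_cases hjk : j < k
    · rw [Sr_elt hS hr (j := j + 1) (by omega) (by omega)]
      have := elt_lt hS a (Nat.lt_succ_self j) hjk
      simp only [Nat.succ_eq_add_one] at this
      by_cases hj1 : j + 1 = r
      · subst hj1
        simp only [if_true]
        omega
      · simp only [if_neg hj1]; tauto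
    · tauto

lemma In_Sr {n k : ℕ} {S : Finset ℕ} (hS : S ∈ Sset n k) {r : ℕ} (hr : r ∈ OutS n k S) (j : ℕ) :
    j ∈ InS k (Sr S r) ↔ j ∈ InS k S ∨ j = r := by
  rw [mem_In, mem_In]
  obtain ⟨h1, h2, h3, h4, h5⟩ := (mem_Out hS r).1 hr
  by_cases hj : 1 ≤ j ∧ j ≤ k
  swap
  · constructor
    · tauto
    · rintro (h | rfl)
      · tauto
      · tauto
  obtain ⟨a, b⟩ := hj
  rw [Sr_elt hS hr a b]
  have hb := elt_bd hS a b
  by_cases hjr : j = r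
  · subst hjr
    simp only [if_true, or_true, iff_true]
    refine ⟨a, b, by omega, by omega, ?_⟩
    intro h
    rw [Sr_elt hS hr (by omega) (by omega), if_neg (by omega)]
    have := elt_lt hS (i := j - 1) (j := j) (by omega) (by omega) b
    omega
  · rw [if_neg hjr, or_iff_left hjr]
    by_cases hj1 : 1 < j
    · rw [Sr_elt hS hr (j := j - 1) (by omega) (by omega)]
      by_cases hj2 : j - 1 = r
      · subst hj2
        have := h5 (by omega)
        rw [show j - 1 + 1 = j by omega] at this
        simp only [if_true]
        omega
      · simp only [if_neg hj2]
    · tauto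

lemma dr_Sr {n k : ℕ} {S : Finset ℕ} (hS : S ∈ Sset n k) {r : ℕ} (hr : r ∈ OutS n k S) {j : ℕ}
    (hj : 1 ≤ j) : dr (Sr S r) j = dr S j + if j ≤ r then 1 else 0 := by
  obtain ⟨h1, h2, -⟩ := (mem_Out hS r).1 hr
  simp only [dr, card_eq hS, card_eq (Sr_mem hS hr)]
  have : ∀ i ∈ Finset.Icc j k, elt (Sr S r) i - i = (elt S i - i) + if i = r then 1 else 0 := by
    intro i hi
    rw [Finset.mem_Icc] at hi
    rw [Sr_elt hS hr (by omega) hi.2]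
    have := elt_ge hS hi.2
    split_ifs with h
    · subst h; omega
    · omega
  rw [Finset.sum_congr rfl this, Finset.sum_add_distrib]
  congr 1
  rw [Finset.sum_ite_eq']
  simp [h2]

lemma dS_Sr {n k : ℕ} {S : Finset ℕ} (hS : S ∈ Sset n k) {r : ℕ} (hr : r ∈ OutS n k S) :
    dS (Sr S r) = dS S + 1 := by
  obtain ⟨h1, -⟩ := (mem_Out hS r).1 hr
  rw [dS, dr_Sr hS hr le_rfl, if_pos h1, dS]

lemma Sr_inj {n k : ℕ} {S T : Finset ℕ} (hS : S ∈ Sset n k) (hT : T ∈ Sset n k) {r : ℕ}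
    (hr : r ∈ OutS n k S) (hr' : r ∈ OutS n k T) (h : Sr S r = Sr T r) : S = T := by
  apply ext_elt hS hT
  intro j a b
  have h1 := Sr_elt hS hr a b
  have h2 := Sr_elt hT hr' a b
  rw [h] at h1
  split_ifs at h1 h2 with h
  · subst h; omega
  · omega

lemma Sr_comm {n k : ℕ} {S : Finset ℕ} (hS : S ∈ Sset n k) {r s : ℕ}
    (hr : r ∈ OutS n k S) (hs : s ∈ OutS n k S) (h : r ≠ s) :
    Sr (Sr S r) s = Sr (Sr S s) r := by
  have hs' : s ∈ OutS n k (Sr S r) := (Out_Sr hS hr s).2 ⟨hs, h.symm⟩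
  have hr' : r ∈ OutS n k (Sr S s) := (Out_Sr hS hs r).2 ⟨hr, h⟩
  obtain ⟨r1, r2, -⟩ := (mem_Out hS r).1 hr
  obtain ⟨s1, s2, -⟩ := (mem_Out hS s).1 hs
  apply ext_elt (Sr_mem (Sr_mem hS hr) hs') (Sr_mem (Sr_mem hS hs) hr')
  intro j a b
  rw [Sr_elt (Sr_mem hS hr) hs' a b, Sr_elt (Sr_mem hS hs) hr' a b, Sr_elt hS hr a b,
    Sr_elt hS hs a b, Sr_elt hS hr s1 s2, Sr_elt hS hs r1 r2]
  split_ifs <;> omega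

lemma exists_down {n k : ℕ} {T : Finset ℕ} (hT : T ∈ Sset n k) {r : ℕ} (hr : r ∈ InS k T) :
    ∃ S ∈ Sset n k, r ∈ OutS n k S ∧ T = Sr S r := by
  obtain ⟨h1, h2, h3, h4, h5⟩ := (mem_In r).1 hr
  obtain ⟨S, hS, hSe⟩ := exists_set (n := n) (k := k)
    (fun j => if j = r then elt T r - 1 else elt T j) (by
      intro j a b
      have := elt_bd hT a b
      split_ifs with h
      · subst h
        rcases Nat.lt_or_ge 1 j with h | h
        · have := h5 h
          omega
        · have := h4 (by omega)
          omega
      · exact this) (by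
      intro i j a b c
      have := elt_lt hT a b c
      split_ifs with h h' h'
      · omega
      · subst h; omega
      · subst h'
        have := h5 (by omega)
        rcases Nat.lt_or_ge i (j - 1) with h | h
        · have := elt_lt hT a h (by omega)
          omega
        · have : i = j - 1 := by omega
          subst this; omega
      · exact this)
  have hpos := elt_bd hT h1 h2
  have hr' : r ∈ OutS n k S := by
    rw [mem_Out hS]
    have e := hSe r h1 h2
    simp only [if_true] at e
    refine ⟨h1, h2, by omega, by omega, ?_⟩
    intro h
    have := hSe (r + 1) (by omega) (by omega)
    rw [if_neg (by omega)] at this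
    have := elt_lt hT h1 (Nat.lt_succ_self r) h
    simp only [Nat.succ_eq_add_one] at this
    omega
  refine ⟨S, hS, hr', ext_elt hT (Sr_mem hS hr') ?_⟩
  intro j a b
  rw [Sr_elt hS hr' a b, hSe j a b, hSe r h1 h2, if_pos rfl]
  split_ifs with h
  · subst h; omega
  · rfl

lemma In_not_Out {n k : ℕ} {S : Finset ℕ} {j : ℕ} (h : j ∈ InS k S) :
    j ∉ OutS n k S := by
  simp only [InS, OutS, Finset.mem_filter] at *
  tauto

lemma J_Sr {n k : ℕ} {S : Finset ℕ} (hS : S ∈ Sset n k) {r : ℕ} (hr : r ∈ OutS n k S) :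
    InS k (Sr S r) ∪ OutS n k (Sr S r) = InS k S ∪ OutS n k S := by
  ext j
  simp only [Finset.mem_union, In_Sr hS hr, Out_Sr hS hr]
  by_cases h : j = r
  · subst h; tauto
  · tauto

/-- Half of the Schubert differential. -/
noncomputable def P (n k : ℕ) : Matrix ↥(Sset n k) ↥(Sset n k) ℤ := fun T S =>
  ∑ r ∈ OutS n k S.1, if T.1 = Sr S.1 r then (-1 : ℤ) ^ dr S.1 r else 0

lemma schubD_eq (n k : ℕ) : schubD n k ℤ = (2 : ℤ) • P n k := by
  ext T S
  simp only [schubD, schubCoeff, P, Matrix.smul_apply, smul_eq_mul, OutS, Finset.sum_filter,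
    Finset.mul_sum]
  apply Finset.sum_congr rfl
  intro r _
  have h1 : Odd ((k : ℤ) - elt S.1 r) ↔ ¬ (elt S.1 r % 2 = k % 2) := by
    rw [Int.odd_iff]; omega
  have h2 : 1 < nxt n S.1 r - elt S.1 r ↔ elt S.1 r + 1 < nxt n S.1 r := by omega
  simp only [h1, h2]
  split_ifs <;> first | ring1 | tauto

lemma P_ne {n k : ℕ} {T S : ↥(Sset n k)} (h : P n k T S ≠ 0) :
    ∃ r ∈ OutS n k S.1, T.1 = Sr S.1 r := by
  obtain ⟨r, hr, h'⟩ := Finset.exists_ne_zero_of_sum_ne_zero h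
  refine ⟨r, hr, ?_⟩
  by_contra hc
  exact h' (if_neg hc)

lemma P_sq (n k : ℕ) : P n k * P n k = 0 := by
  ext U S
  rw [Matrix.mul_apply, Matrix.zero_apply]
  obtain ⟨S, hS⟩ := S
  have key : ∑ T, P n k U T * P n k T ⟨S, hS⟩ =
      ∑ r ∈ OutS n k S, ∑ s ∈ OutS n k S, if r ≠ s then
        (if U.1 = Sr (Sr S r) s then (-1 : ℤ) ^ (dr (Sr S r) s + dr S r) else 0) else 0 := by
    have : ∀ T, P n k U T * P n k T ⟨S, hS⟩ =
      ∑ r ∈ OutS n k S, if T.1 = Sr S r then P n k U T * (-1 : ℤ) ^ dr S r else 0 := by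
      intro T
      conv_lhs => rw [show P n k T ⟨S, hS⟩ = ∑ r ∈ OutS n k S, if T.1 = Sr S r then (-1 : ℤ) ^ dr S r else 0 from rfl, Finset.mul_sum]
      apply Finset.sum_congr rfl
      intro r _
      split_ifs
      · rfl
      · simp
    simp only [this]
    rw [Finset.sum_comm]
    apply Finset.sum_congr rfl
    intro r hr
    rw [Finset.sum_eq_single (⟨Sr S r, Sr_mem hS hr⟩ : ↥(Sset n k))]
    · have : OutS n k (Sr S r) = (OutS n k S).filter (fun s => r ≠ s) := by
        ext j
        rw [Out_Sr hS hr, Finset.mem_filter, ne_comm]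
      simp only [if_true, P, this, Finset.sum_filter, Finset.sum_mul]
      apply Finset.sum_congr rfl
      intro s _
      split_ifs <;> simp [pow_add]
    · intro T _ hT
      rw [if_neg]
      intro h; exact hT (Subtype.ext h)
    · simp
  rw [key, ← Finset.sum_product']
  apply Finset.sum_involution (fun p _ => (p.2, p.1))
  · rintro ⟨r, s⟩ h
    simp only [Finset.mem_product] at h
    obtain ⟨hr, hs⟩ := h
    by_cases hrs : r = s
    · simp [hrs]
    · have hsr : s ≠ r := fun h => hrs h.symm
      simp only [ne_eq, hrs, hsr, not_false_eq_true, if_true]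
      rw [Sr_comm hS hr hs hrs]
      have a1 := ((mem_Out hS r).1 hr).1
      have a2 := ((mem_Out hS s).1 hs).1
      rw [dr_Sr hS hr a2, dr_Sr hS hs a1]
      split_ifs <;> first | omega | ring1
  · rintro ⟨r, s⟩ h hne heq
    simp only [Prod.mk.injEq] at heq
    apply hne
    simp [heq.1]
  · rintro ⟨r, s⟩ h
    simp only [Finset.mem_product] at h ⊢
    exact ⟨h.2, h.1⟩
  · rintro ⟨r, s⟩ h
    rfl

/-- The algebraic core: a square-zero matrix with a unimodular matching splits. -/
lemma split_iso {F M ι : Type*} [Fintype F] [Fintype M] [Fintype ι]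
    (φ : (F ⊕ M × Fin 2) ≃ ι) (P : Matrix ι ι ℤ) (D : Matrix ι ι ℤ) (hD : D = (2 : ℤ) • P)
    (N : Matrix (F ⊕ M × Fin 2) (F ⊕ M × Fin 2) ℤ)
    (hN : ∀ w : F ⊕ M × Fin 2 → ℤ, ∀ x, N.mulVec w x =
      Sum.elim (fun _ => 0) (fun p => if p.2 = 1 then 2 * w (Sum.inr (p.1, 0)) else 0) x)
    (hP : P * P = 0) (deg : ι → ℤ) (deg₂ : F ⊕ M × Fin 2 → ℤ) (hdeg : ∀ x, deg₂ x = deg (φ x))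
    (hM : ∀ S, deg₂ (Sum.inr (S, 1)) = deg₂ (Sum.inr (S, 0)) + 1)
    (hPd : ∀ x y, P x y ≠ 0 → deg x = deg y + 1)
    (hF1 : ∀ f y, P (φ (Sum.inl f)) y = 0) (hF2 : ∀ f x, P x (φ (Sum.inl f)) = 0)
    (hE : ∀ S T, S ≠ T → P (φ (Sum.inr (S, 1))) (φ (Sum.inr (T, 0))) = 0)
    (hE' : ∀ S, P (φ (Sum.inr (S, 1))) (φ (Sum.inr (S, 0))) *
      P (φ (Sum.inr (S, 1))) (φ (Sum.inr (S, 0))) = 1) :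
    CxIso ℤ D deg N deg₂ := by
  set ε : M → ℤ := fun S => P (φ (Sum.inr (S, 1))) (φ (Sum.inr (S, 0))) with hε
  set A : M → M → ℤ := fun S T => P (φ (Sum.inr (S, 0))) (φ (Sum.inr (T, 0))) with hA
  -- the map from the split complex
  let G : ((F ⊕ M × Fin 2) → ℤ) →ₗ[ℤ] (ι → ℤ) :=
    { toFun := fun w i => Sum.elim (fun f => w (Sum.inl f))
        (fun p => if p.2 = 0 then w (Sum.inr (p.1, 0)) + ∑ T, A p.1 T * w (Sum.inr (T, 1))
          else ε p.1 * w (Sum.inr (p.1, 1))) (φ.symm i)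
      map_add' := by
        intro v w; ext i
        simp only [Pi.add_apply]
        rcases φ.symm i with f | ⟨S, j⟩
        · simp
        · simp only [Sum.elim_inr, Pi.add_apply, mul_add, Finset.sum_add_distrib]
          split_ifs <;> ring
      map_smul' := by
        intro c w; ext i
        simp only [Pi.smul_apply]
        rcases φ.symm i with f | ⟨S, j⟩
        · simp
        · simp only [Sum.elim_inr, Pi.smul_apply, smul_eq_mul, RingHom.id_apply]
          split_ifs
          · rw [mul_add, Finset.mul_sum]
            congr 1
            apply Finset.sum_congr rfl
            intros; ring
          · ring }
  have G0 : ∀ w f, G w (φ (Sum.inl f)) = w (Sum.inl f) := by intro w f; simp [G]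
  have G1 : ∀ w S, G w (φ (Sum.inr (S, 0))) =
      w (Sum.inr (S, 0)) + ∑ T, A S T * w (Sum.inr (T, 1)) := by intro w S; simp [G]
  have G2 : ∀ w S, G w (φ (Sum.inr (S, 1))) = ε S * w (Sum.inr (S, 1)) := by
    intro w S; simp [G]
  let H : (ι → ℤ) → ((F ⊕ M × Fin 2) → ℤ) := fun v =>
    Sum.elim (fun f => v (φ (Sum.inl f)))
      (fun p => if p.2 = 0 then v (φ (Sum.inr (p.1, 0))) -
          ∑ T, A p.1 T * (ε T * v (φ (Sum.inr (T, 1))))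
        else ε p.1 * v (φ (Sum.inr (p.1, 1))))
  have H0 : ∀ v f, H v (Sum.inl f) = v (φ (Sum.inl f)) := by intro w f; simp [H]
  have H1 : ∀ v S, H v (Sum.inr (S, 0)) = v (φ (Sum.inr (S, 0))) -
          ∑ T, A S T * (ε T * v (φ (Sum.inr (T, 1)))) := by intro w S; simp [H]
  have H2 : ∀ v S, H v (Sum.inr (S, 1)) = ε S * v (φ (Sum.inr (S, 1))) := by
    intro w S; simp [H]
  have HG : ∀ w, H (G w) = w := by
    intro w
    ext x
    rcases x with f | ⟨S, j⟩
    · rw [H0, G0]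
    · fin_cases j
      · change H (G w) (Sum.inr (S, 0)) = w (Sum.inr (S, 0))
        rw [H1, G1]
        simp only [G2, ← mul_assoc]
        simp only [mul_assoc (A _ _), hE', hε, mul_one]
        ring
      · change H (G w) (Sum.inr (S, 1)) = w (Sum.inr (S, 1))
        rw [H2, G2, ← mul_assoc, hE', one_mul]
  have GH : ∀ v, G (H v) = v := by
    intro v
    ext i
    obtain ⟨x, rfl⟩ := φ.surjective i
    rcases x with f | ⟨S, j⟩
    · rw [G0, H0]
    · fin_cases j
      · change G (H v) (φ (Sum.inr (S, 0))) = v (φ (Sum.inr (S, 0)))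
        rw [G1, H1]
        simp only [H2]
        ring
      · change G (H v) (φ (Sum.inr (S, 1))) = v (φ (Sum.inr (S, 1)))
        rw [G2, H2, ← mul_assoc, hE', one_mul]
  let e : ((F ⊕ M × Fin 2) → ℤ) ≃ₗ[ℤ] (ι → ℤ) := { G with invFun := H, left_inv := HG, right_inv := GH }
  have he : ∀ w, e w = G w := fun _ => rfl
  have hes : ∀ v, e.symm v = H v := fun _ => rfl
  -- columns of G
  have expand : ∀ w i, G w i = (∑ f, if i = φ (Sum.inl f) then w (Sum.inl f) else 0) +
      (∑ S, if i = φ (Sum.inr (S, 0)) then w (Sum.inr (S, 0)) else 0) +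
      ∑ T, P i (φ (Sum.inr (T, 0))) * w (Sum.inr (T, 1)) := by
    intro w i
    obtain ⟨x, rfl⟩ := φ.surjective i
    rcases x with f | ⟨S, j⟩
    · rw [G0]; simp [hF1]
    · fin_cases j
      · change G w (φ (Sum.inr (S, 0))) = _
        rw [G1]; simp [hA]
      · change G w (φ (Sum.inr (S, 1))) = _
        rw [G2]
        have hs : ∑ T, P (φ (Sum.inr (S, 1))) (φ (Sum.inr (T, 0))) * w (Sum.inr (T, 1)) =
            ε S * w (Sum.inr (S, 1)) := by
          rw [Finset.sum_eq_single S (by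
            intro T _ hT
            rw [hE S T hT.symm, zero_mul]) (by simp)]
        simp only [Fin.mk_one]
        rw [hs]
        simp
  have comm : ∀ w, D.mulVec (G w) = G (N.mulVec w) := by
    intro w
    ext i
    rw [expand, hD, Matrix.smul_mulVec, Pi.smul_apply, smul_eq_mul]
    simp only [hN, Sum.elim_inl, Sum.elim_inr, ite_self, Finset.sum_const_zero, zero_add, if_true,
      zero_ne_one, if_false]
    have : ∀ T, P i (φ (Sum.inr (T, 0))) * (2 * w (Sum.inr (T, 0))) =
      2 * (P i (φ (Sum.inr (T, 0))) * w (Sum.inr (T, 0))) := by intro T; ring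
    simp only [this, ← Finset.mul_sum]
    congr 1
    rw [Matrix.mulVec, dotProduct]
    simp only [expand, mul_add, Finset.sum_add_distrib, Finset.mul_sum, mul_ite, mul_zero]
    have e1 : ∑ x, ∑ f, (if x = φ (Sum.inl f) then P i x * w (Sum.inl f) else 0) = 0 := by
      rw [Finset.sum_comm]
      simp [hF2]
    have e2 : ∑ x, ∑ S, (if x = φ (Sum.inr (S, 0)) then P i x * w (Sum.inr (S, 0)) else 0) =
        ∑ T, P i (φ (Sum.inr (T, 0))) * w (Sum.inr (T, 0)) := by
      rw [Finset.sum_comm]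
      simp
    have e3 : ∑ x, ∑ T, P i x * (P x (φ (Sum.inr (T, 0))) * w (Sum.inr (T, 1))) = 0 := by
      rw [Finset.sum_comm]
      apply Finset.sum_eq_zero
      intro T _
      simp only [← mul_assoc, ← Finset.sum_mul]
      rw [← Matrix.mul_apply, hP]; simp
    rw [e1, e2, e3]; simp
  have hAd : ∀ S T, A S T ≠ 0 → deg₂ (Sum.inr (S, 0)) = deg₂ (Sum.inr (T, 1)) := by
    intro S T h
    rw [hM, hdeg, hdeg, hPd _ _ h]
  refine ⟨e.symm, ?_, ?_, ?_⟩
  · intro v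
    rw [LinearEquiv.symm_apply_eq, he, ← comm, ← he, e.apply_symm_apply]
  · intro m v hv x hx
    rw [hes]
    rcases x with f | ⟨S, j⟩
    · rw [H0]; apply hv; rwa [← hdeg]
    · fin_cases j
      · change deg₂ (Sum.inr (S, 0)) ≠ m at hx
        change H v (Sum.inr (S, 0)) = 0
        rw [H1, hv _ (by rwa [← hdeg]), Finset.sum_eq_zero, sub_zero]
        intro T _
        by_cases h : A S T = 0
        · rw [h, zero_mul]
        · rw [hv (φ (Sum.inr (T, 1))) (by rwa [← hdeg, ← hAd S T h]), mul_zero, mul_zero]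
      · change deg₂ (Sum.inr (S, 1)) ≠ m at hx
        change H v (Sum.inr (S, 1)) = 0
        rw [H2, hv _ (by rwa [← hdeg]), mul_zero]
  · intro m w hw i hi
    change G w i = 0
    obtain ⟨x, rfl⟩ := φ.surjective i
    rw [← hdeg] at hi
    rcases x with f | ⟨S, j⟩
    · rw [G0, hw _ hi]
    · fin_cases j
      · change deg₂ (Sum.inr (S, 0)) ≠ m at hi
        change G w (φ (Sum.inr (S, 0))) = 0
        rw [G1, hw _ hi, Finset.sum_eq_zero, add_zero]
        intro T _
        by_cases h : A S T = 0
        · rw [h, zero_mul]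
        · rw [hw (Sum.inr (T, 1)) (by rwa [← hAd S T h]), mul_zero]
      · change deg₂ (Sum.inr (S, 1)) ≠ m at hi
        change G w (φ (Sum.inr (S, 1))) = 0
        rw [G2, hw _ hi, mul_zero]

lemma coneSum_mulVec (n k : ℕ) (w : ↥(freeIdx n k) ⊕ ↥(minIdx n k) × Fin 2 → ℤ) (x) :
    (coneSumD n k).mulVec w x =
      Sum.elim (fun _ => 0) (fun p => if p.2 = 1 then 2 * w (Sum.inr (p.1, 0)) else 0) x := by
  rw [Matrix.mulVec, dotProduct, Fintype.sum_sum_type, Fintype.sum_prod_type]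
  rcases x with f | ⟨S, j⟩
  · simp [coneSumD]
  · simp only [coneSumD, zero_mul, Finset.sum_const_zero, zero_add, Fin.sum_univ_two, Sum.elim_inr]
    rw [Finset.sum_eq_single S]
    · simp
    · intro T _ hT
      simp [hT.symm]
    · simp

lemma exists_match {n k : ℕ} (S : ↥(minIdx n k)) : ∃ U : ↥(Sset n k), ∃ i,
    i ∈ OutS n k U.1 ∧ (∀ j ∈ InS k U.1 ∪ OutS n k U.1, i ≤ j) ∧ S.1 = Sr U.1 i := by
  obtain ⟨S, hS⟩ := S
  obtain ⟨hS, i, hi, hmin⟩ := Finset.mem_filter.1 hS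
  obtain ⟨U, hU, hiU, rfl⟩ := exists_down hS hi
  refine ⟨⟨U, hU⟩, i, hiU, ?_, rfl⟩
  rwa [J_Sr hU hiU] at hmin

end Schub

/-- the Schubert cochain complex over `ℤ` is isomorphic, as a cochain complex of
abelian groups, to
`(⊕_{S : In(S) = ∅ = Out(S)} ℤ[d(S)]) ⊕ (⊕_{S ∈ {n;k}_Min} (ℤ →2→ ℤ)` in degrees
`d(S) − 1, d(S))`. -/
theorem stmt4 (n k : ℕ) (hk : k ≤ n) :
    CxIso ℤ (schubD n k ℤ) (fun S => (dS S.1 : ℤ))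
      (coneSumD n k)
      (Sum.elim (fun S => (dS S.1 : ℤ))
        (fun p => (dS p.1.1 : ℤ) - 1 + ((p.2 : ℕ) : ℤ))) := by
  choose τ i hi hmin hτ using Schub.exists_match (n := n) (k := k)
  have hminIn : ∀ S : ↥(minIdx n k), i S ∈ InS k S.1 := fun S => by
    rw [hτ S, Schub.In_Sr (τ S).2 (hi S)]; exact Or.inr rfl
  have memS : ∀ S : ↥(minIdx n k), S.1 ∈ Sset n k := fun S => (Finset.mem_filter.1 S.2).1
  have hJ : ∀ S : ↥(minIdx n k), InS k S.1 ∪ OutS n k S.1 =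
      InS k (τ S).1 ∪ OutS n k (τ S).1 := fun S => by
    conv_lhs => rw [hτ S]
    exact Schub.J_Sr (τ S).2 (hi S)
  have iJ : ∀ S : ↥(minIdx n k), i S ∈ InS k (τ S).1 ∪ OutS n k (τ S).1 := fun S =>
    Finset.mem_union_right _ (hi S)
  have ieq : ∀ S T : ↥(minIdx n k), InS k (τ S).1 ∪ OutS n k (τ S).1 =
      InS k (τ T).1 ∪ OutS n k (τ T).1 → i S = i T := fun S T h =>
    le_antisymm (hmin S _ (h ▸ iJ T)) (hmin T _ (h ▸ iJ S))
  let φ : (↥(freeIdx n k) ⊕ ↥(minIdx n k) × Fin 2) → ↥(Sset n k) :=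
    Sum.elim (fun f => ⟨f.1, (Finset.mem_filter.1 f.2).1⟩)
      (fun p => if p.2 = 0 then τ p.1 else ⟨p.1.1, memS p.1⟩)
  have φ0 : ∀ f, (φ (Sum.inl f)).1 = f.1 := fun f => rfl
  have φ1 : ∀ S, φ (Sum.inr (S, 0)) = τ S := fun S => by simp [φ]
  have φ2 : ∀ S, (φ (Sum.inr (S, 1))).1 = S.1 := fun S => by simp [φ]
  have hfree : ∀ f : ↥(freeIdx n k), ∀ j, j ∉ InS k f.1 ∧ j ∉ OutS n k f.1 := fun f j => by
    obtain ⟨_, h1, h2⟩ := Finset.mem_filter.1 f.2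
    simp [h1, h2]
  have hne : ∀ S T : ↥(minIdx n k), S.1 ≠ (τ T).1 := by
    intro S T h
    have h1 := hminIn S
    have h2 := hi T
    have h3 : i S = i T := ieq S T (by rw [← hJ S, h])
    rw [← h, ← h3] at h2
    exact Schub.In_not_Out h1 h2
  have φinj : Function.Injective φ := by
    intro x y hxy
    rcases x with f | ⟨S, a⟩ <;> rcases y with g | ⟨T, b⟩
    · have := congrArg Subtype.val hxy
      rw [φ0, φ0] at this
      rw [Subtype.ext this]
    · exfalso
      fin_cases b
      · change φ _ = φ (Sum.inr (T, 0)) at hxy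
        rw [φ1] at hxy
        have := hi T
        rw [← hxy] at this
        exact (hfree f _).2 this
      · change φ _ = φ (Sum.inr (T, 1)) at hxy
        have := hminIn T
        rw [← φ2, ← hxy] at this
        exact (hfree f _).1 this
    · exfalso
      fin_cases a
      · change φ (Sum.inr (S, 0)) = _ at hxy
        rw [φ1] at hxy
        have := hi S
        rw [hxy] at this
        exact (hfree g _).2 this
      · change φ (Sum.inr (S, 1)) = _ at hxy
        have := hminIn S
        rw [← φ2, hxy] at this
        exact (hfree g _).1 this
    · fin_cases a <;> fin_cases b
      · change φ (Sum.inr (S, 0)) = φ (Sum.inr (T, 0)) at hxy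
        rw [φ1, φ1] at hxy
        have h3 : i S = i T := ieq S T (by rw [hxy])
        have : S = T := Subtype.ext (by rw [hτ S, hτ T, hxy, h3])
        rw [this]
      · change φ (Sum.inr (S, 0)) = φ (Sum.inr (T, 1)) at hxy
        have := congrArg Subtype.val hxy
        rw [φ1, φ2] at this
        exact (hne _ _ this.symm).elim
      · change φ (Sum.inr (S, 1)) = φ (Sum.inr (T, 0)) at hxy
        have := congrArg Subtype.val hxy
        rw [φ1, φ2] at this
        exact (hne _ _ this).elim
      · change φ (Sum.inr (S, 1)) = φ (Sum.inr (T, 1)) at hxy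
        have := congrArg Subtype.val hxy
        rw [φ2, φ2] at this
        rw [Subtype.ext this]
  have φsurj : Function.Surjective φ := by
    rintro ⟨U, hU⟩
    by_cases hemp : (InS k U ∪ OutS n k U).Nonempty
    · have hm := Finset.min'_mem _ hemp
      have hle := fun j hj => Finset.min'_le (InS k U ∪ OutS n k U) j hj
      set m := (InS k U ∪ OutS n k U).min' hemp
      rcases Finset.mem_union.1 hm with h | h
      · refine ⟨Sum.inr (⟨U, Finset.mem_filter.2 ⟨hU, m, h, hle⟩⟩, 1), ?_⟩
        apply Subtype.ext
        rw [φ2]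
      · have hS : Sr U m ∈ minIdx n k := by
          refine Finset.mem_filter.2 ⟨Schub.Sr_mem hU h, m, ?_, ?_⟩
          · rw [Schub.In_Sr hU h]; exact Or.inr rfl
          · rw [Schub.J_Sr hU h]; exact hle
        refine ⟨Sum.inr (⟨Sr U m, hS⟩, 0), ?_⟩
        rw [φ1]
        set S : ↥(minIdx n k) := ⟨Sr U m, hS⟩ with hSdef
        have hJ' : InS k (τ S).1 ∪ OutS n k (τ S).1 = InS k U ∪ OutS n k U := by
          rw [← hJ S]; exact Schub.J_Sr hU h
        have him : i S = m := le_antisymm (hmin S _ (hJ' ▸ hm)) (hle _ (hJ' ▸ iJ S))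
        have h1 := hi S
        have h2 := hτ S
        rw [him] at h1 h2
        exact Subtype.ext (Schub.Sr_inj hU (τ S).2 h h1 h2).symm
    · rw [Finset.not_nonempty_iff_eq_empty, Finset.union_eq_empty] at hemp
      exact ⟨Sum.inl ⟨U, Finset.mem_filter.2 ⟨hU, hemp⟩⟩, rfl⟩
  have hbij : Function.Bijective φ := ⟨φinj, φsurj⟩
  have hφ : ∀ x, Equiv.ofBijective φ hbij x = φ x := fun _ => rfl
  generalize Equiv.ofBijective φ hbij = ψ at hφ
  refine Schub.split_iso ψ (Schub.P n k) _ (Schub.schubD_eq n k) _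
    (Schub.coneSum_mulVec n k) (Schub.P_sq n k) _ _ ?_ ?_ ?_ ?_ ?_ ?_ ?_
  · intro x
    simp only [hφ]
    rcases x with f | ⟨S, a⟩
    · rfl
    · fin_cases a
      · change (dS S.1 : ℤ) - 1 + ((0 : ℕ) : ℤ) = (dS (φ (Sum.inr (S, 0))).1 : ℤ)
        rw [φ1]
        conv_lhs => rw [hτ S, Schub.dS_Sr (τ S).2 (hi S)]
        push_cast; ring
      · change (dS S.1 : ℤ) - 1 + ((1 : ℕ) : ℤ) = (dS (φ (Sum.inr (S, 1))).1 : ℤ)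
        rw [φ2]
        push_cast; ring
  · intro S
    simp
  · intro x y h
    obtain ⟨r, hr, h⟩ := Schub.P_ne h
    rw [h, Schub.dS_Sr y.2 hr]
    push_cast; ring
  · intro f y
    by_contra h
    obtain ⟨r, hr, h⟩ := Schub.P_ne h
    simp only [hφ, φ0] at h
    apply (hfree f r).1
    rw [h, Schub.In_Sr y.2 hr]
    exact Or.inr rfl
  · intro f x
    by_contra h
    obtain ⟨r, hr, h⟩ := Schub.P_ne h
    rw [hφ, φ0] at hr
    exact (hfree f r).2 hr
  · intro S T hST
    simp only [hφ, φ1]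
    by_contra h
    obtain ⟨r, hr, h⟩ := Schub.P_ne h
    rw [φ2] at h
    have h3 : i S = i T := ieq S T (by rw [← hJ S, h, Schub.J_Sr (τ T).2 hr])
    have h4 := hminIn S
    rw [h, Schub.In_Sr (τ T).2 hr, h3] at h4
    rcases h4 with h4 | h4
    · exact Schub.In_not_Out h4 (hi T)
    · exact hST (Subtype.ext (by rw [h, hτ T, h4]))
  · intro S
    simp only [hφ, φ1]
    have : Schub.P n k (φ (Sum.inr (S, 1))) (τ S) = (-1) ^ dr (τ S).1 (i S) := by
      simp only [Schub.P, φ2]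
      rw [Finset.sum_eq_single_of_mem (i S) (hi S)]
      · rw [if_pos (hτ S)]
      · intro r hr hne'
        rw [if_neg]
        intro h
        have h4 := hminIn S
        rw [h, Schub.In_Sr (τ S).2 hr] at h4
        rcases h4 with h4 | h4
        · exact Schub.In_not_Out h4 (hi S)
        · exact hne' h4.symm
    rw [this, ← pow_add, ← two_mul, pow_mul]
    simp
end

section
/- Let 0 ≤ k ≤ n be integers and R a commutative ring. The Schubert cochain complex over R is isomorphic, as a cochain complex of R-modules, to the direct sum of: (i) for each S ∈ {n;k} with In(S) = ∅ and Out(S) = ∅, a copy of R concentrated in degree d(S); and (ii) for each S ∈ {n;k} with Out(S) = ∅ and In(S) ≠ ∅, and each 0 ≤ a < card(In(S)), binom(card(In(S)) − 1, a) copies of the two-term complex R →2→ R occupying cohomological degrees d(S) − a − 1 and d(S) − a. -/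
open scoped BigOperators Classical

/-- The index set for the cone part: triples `(S, a, c)` with `S ∈ {n;k}`, `Out(S) = ∅`,
`In(S) ≠ ∅`, `0 ≤ a < card In(S)` and `c < binom(card In(S) − 1, a)` selecting one of the
copies of the two-term complex in cohomological degrees `d(S) − a − 1`, `d(S) − a`. -/
noncomputable def coneIdx (n k : ℕ) : Finset (Finset ℕ × ℕ × ℕ) :=
  ((((Sset n k).filter fun S => OutS n k S = ∅ ∧ InS k S ≠ ∅)) ×ˢ
      (Finset.range k ×ˢ Finset.range (2 ^ k))).filter
    fun p => p.2.1 < (InS k p.1).card ∧ p.2.2 < Nat.choose ((InS k p.1).card - 1) p.2.1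

/-- The differential of the target complex of Statement 13: zero on the summands `R[d(S)]`,
and multiplication by `2` from the degree `d(S)−a−1` generator (labelled `0`) to the degree
`d(S)−a` generator (labelled `1`) of each copy of the two-term complex. -/
noncomputable def coneSumD13 (n k : ℕ) (R : Type*) [CommRing R] :
    Matrix (↥(freeIdx n k) ⊕ ↥(coneIdx n k) × Fin 2)
      (↥(freeIdx n k) ⊕ ↥(coneIdx n k) × Fin 2) R :=
  fun x y =>
    match x, y with
    | .inr (p, i), .inr (q, j) => if p = q ∧ i = 1 ∧ j = 0 then 2 else 0
    | _, _ => 0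

section generic

/-- Generic linear algebra: a complex with a perfect matching by units splits. -/
theorem generic_split {X F C : Type*} [Fintype X] [Fintype F] [Fintype C]
    (R : Type*) [CommRing R]
    (dd : Matrix X X R) (D : Matrix X X R) (hD : ∀ x y, D x y = 2 * dd x y)
    (hdd : ∀ x y, ∑ z, dd x z * dd z y = 0)
    (deg : X → ℤ) (hdeg : ∀ x y, dd x y ≠ 0 → deg x = deg y + 1)
    (β : F ⊕ C × Fin 2 ≃ X) (ε : C → R) (hε : ∀ c, ε c * ε c = 1)
    (hF : ∀ x f, dd x (β (.inl f)) = 0)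
    (hC : ∀ c c', dd (β (.inr (c', 1))) (β (.inr (c, 0))) = if c' = c then ε c else 0)
    (hdC : ∀ c, deg (β (.inr (c, 1))) = deg (β (.inr (c, 0))) + 1)
    (D₂ : Matrix (F ⊕ C × Fin 2) (F ⊕ C × Fin 2) R)
    (hD₂ : ∀ x y, D₂ x y = match x, y with
      | .inr (p, i), .inr (q, j) => if p = q ∧ i = 1 ∧ j = 0 then 2 else 0
      | _, _ => 0)
    (deg₂ : F ⊕ C × Fin 2 → ℤ) (hdeg₂ : ∀ y, deg₂ y = deg (β y)) :
    CxIso R D deg D₂ deg₂ := by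
  classical
  -- the matrix on Y
  set m : F ⊕ C × Fin 2 → F ⊕ C × Fin 2 → R := fun x y => dd (β x) (β y) with hm
  have hmm : ∀ x y, ∑ z, m x z * m z y = 0 := by
    intro x y
    rw [← hdd (β x) (β y)]
    exact Equiv.sum_comp β (fun z => dd (β x) z * dd z (β y))
  have hm1 : ∀ c c', m (.inr (c', 1)) (.inr (c, 0)) = if c' = c then ε c else 0 := hC
  have hmF : ∀ x f, m x (.inl f) = 0 := fun x f => hF _ f
  have hmd : ∀ x y, m x y ≠ 0 → deg₂ x = deg₂ y + 1 := by
    intro x y h; rw [hdeg₂, hdeg₂]; exact hdeg _ _ h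
  have hd2C : ∀ c, deg₂ (.inr (c, 1)) = deg₂ (.inr (c, 0)) + 1 := by
    intro c; rw [hdeg₂, hdeg₂]; exact hdC c
  let t0 : (F ⊕ C × Fin 2 → R) → (F ⊕ C × Fin 2 → R) := fun v y =>
    match y with
    | .inl f => v (.inl f)
    | .inr (c, 0) => v (.inr (c, 0))
    | .inr (c, 1) => 0
  let φ : (F ⊕ C × Fin 2 → R) → (F ⊕ C × Fin 2 → R) := fun v y =>
    t0 v y + ∑ c, m y (.inr (c, 0)) * v (.inr (c, 1))
  have φ1 : ∀ v c, φ v (.inr (c, 1)) = ε c * v (.inr (c, 1)) := by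
    intro v c
    simp only [φ, t0, hm1]
    simp
  let ψ : (F ⊕ C × Fin 2 → R) → (F ⊕ C × Fin 2 → R) := fun w y =>
    match y with
    | .inl f => w (.inl f) - ∑ c, m (.inl f) (.inr (c, 0)) * (ε c * w (.inr (c, 1)))
    | .inr (c', 0) => w (.inr (c', 0)) - ∑ c, m (.inr (c', 0)) (.inr (c, 0)) * (ε c * w (.inr (c, 1)))
    | .inr (c, 1) => ε c * w (.inr (c, 1))
  have hεε : ∀ c (x : R), ε c * (ε c * x) = x := by
    intro c x; rw [← mul_assoc, hε, one_mul]
  have hψφ : ∀ v, ψ (φ v) = v := by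
    intro v; funext y
    rcases y with f | ⟨c, i⟩
    · simp only [ψ, φ1, hεε]; simp [φ, t0]
    · fin_cases i
      · simp only [ψ, φ1, hεε, Fin.zero_eta]; simp [φ, t0]
      · simp only [ψ, φ1, hεε, Fin.mk_one]
  have hφψ : ∀ w, φ (ψ w) = w := by
    intro w; funext y
    rcases y with f | ⟨c, i⟩
    · simp [φ, t0, ψ]
    · fin_cases i
      · simp [φ, t0, ψ]
      · simp only [Fin.mk_one, φ1]; simp only [ψ, hεε]
  let Φ : (F ⊕ C × Fin 2 → R) ≃ₗ[R] (F ⊕ C × Fin 2 → R) :=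
    { toFun := φ
      map_add' := by
        intro v w; funext y
        simp only [φ, Pi.add_apply, mul_add, Finset.sum_add_distrib]
        rcases y with f | ⟨c, i⟩
        · simp only [t0, Pi.add_apply]; ring
        · fin_cases i
          · simp only [t0, Pi.add_apply]; ring
          · simp only [t0]; ring
      map_smul' := by
        intro a v; funext y
        simp only [φ, Pi.smul_apply, smul_eq_mul, RingHom.id_apply, mul_add, Finset.mul_sum]
        congr 1
        · rcases y with f | ⟨c, i⟩
          · simp [t0]
          · fin_cases i <;> simp [t0]
        · exact Finset.sum_congr rfl (fun c _ => by ring)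
      invFun := ψ
      left_inv := hψφ
      right_inv := hφψ }
  let e : (X → R) ≃ₗ[R] (F ⊕ C × Fin 2 → R) := (LinearEquiv.funCongrLeft R R β).trans Φ.symm
  have he : ∀ v, e v = ψ (fun y => v (β y)) := fun v => rfl
  have hes : ∀ w x, e.symm w x = φ w (β.symm x) := fun w x => rfl
  have hD2v : ∀ v y, D₂.mulVec v y = match y with
      | .inr (c, 1) => 2 * v (.inr (c, 0))
      | _ => 0 := by
    intro v y
    simp only [Matrix.mulVec, dotProduct, hD₂]
    rcases y with f | ⟨c, i⟩
    · simp
    · simp only [Fintype.sum_sum_type, Fintype.sum_prod_type, Fin.sum_univ_two]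
      fin_cases i <;> simp
  have key : ∀ v y, φ (D₂.mulVec v) y = ∑ z, 2 * m y z * φ v z := by
    intro v y
    have h1 : φ (D₂.mulVec v) y = ∑ c, m y (.inr (c, 0)) * (2 * v (.inr (c, 0))) := by
      simp only [φ]
      have : t0 (D₂.mulVec v) y = 0 := by
        rcases y with f | ⟨c, i⟩
        · simp [t0, hD2v]
        · fin_cases i <;> simp [t0, hD2v]
      rw [this, zero_add]
      exact Finset.sum_congr rfl (fun c _ => by simp only [hD2v])
    rw [h1]
    simp only [φ, mul_add, Finset.sum_add_distrib]
    have h2 : ∑ z, 2 * m y z * ∑ c, m z (.inr (c, 0)) * v (.inr (c, 1)) = 0 := by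
      have : ∀ z, 2 * m y z * ∑ c, m z (.inr (c, 0)) * v (.inr (c, 1))
          = ∑ c, 2 * v (.inr (c, 1)) * (m y z * m z (.inr (c, 0))) := by
        intro z; rw [Finset.mul_sum]; exact Finset.sum_congr rfl (fun c _ => by ring)
      simp only [this]
      rw [Finset.sum_comm]
      simp only [← Finset.mul_sum, hmm, mul_zero, Finset.sum_const_zero]
    rw [h2, add_zero]
    simp only [Fintype.sum_sum_type, Fintype.sum_prod_type, Fin.sum_univ_two, hmF, t0]
    simp only [mul_zero, zero_mul, Finset.sum_const_zero, zero_add, add_zero]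
    exact Finset.sum_congr rfl (fun c _ => by ring)
  refine ⟨e, ?_, ?_, ?_⟩
  · intro v
    apply e.symm.injective
    rw [LinearEquiv.symm_apply_apply]
    obtain ⟨w, rfl⟩ := e.symm.surjective v
    rw [LinearEquiv.apply_symm_apply]
    funext x
    rw [hes, key]
    simp only [Matrix.mulVec, dotProduct, hD, hes]
    rw [← Equiv.sum_comp β]
    simp [hm]
  · intro d v hv j hj
    rw [he]
    have hv' : ∀ y, deg₂ y ≠ d → v (β y) = 0 := by
      intro y hy; apply hv; rwa [← hdeg₂]
    have hs : ∀ y, deg₂ y ≠ d → ∑ c, m y (.inr (c, 0)) * (ε c * v (β (.inr (c, 1)))) = 0 := by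
      intro y hy
      apply Finset.sum_eq_zero
      intro c _
      by_cases h0 : m y (.inr (c, 0)) = 0
      · rw [h0, zero_mul]
      · have := hmd _ _ h0
        rw [hv', mul_zero, mul_zero]
        rw [hd2C]; omega
    rcases j with f | ⟨c, i⟩
    · simp only [ψ]; rw [hs _ hj, hv' _ hj, sub_zero]
    · obtain rfl | rfl : i = 0 ∨ i = 1 := by omega
      · simp only [ψ]; rw [hs _ hj, hv' _ hj, sub_zero]
      · simp only [ψ]; rw [hv' _ hj, mul_zero]
  · intro d w hw x hx
    rw [hes]
    have hx' : deg₂ (β.symm x) ≠ d := by rw [hdeg₂, Equiv.apply_symm_apply]; exact hx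
    generalize β.symm x = y at hx'
    simp only [φ]
    have h0 : t0 w y = 0 := by
      rcases y with f | ⟨c, i⟩
      · simp only [t0]; exact hw _ hx'
      · obtain rfl | rfl : i = 0 ∨ i = 1 := by omega
        · simp only [t0]; exact hw _ hx'
        · simp only [t0]
    rw [h0, zero_add]
    apply Finset.sum_eq_zero
    intro c _
    by_cases h0 : m y (.inr (c, 0)) = 0
    · rw [h0, zero_mul]
    · have := hmd _ _ h0
      rw [hw, mul_zero]
      rw [hd2C]; omega

end generic

section comb

/-- Extended enumeration: `s_0 = 0`, `s_{k+1} = n+1`. -/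
noncomputable def EE (n : ℕ) (S : Finset ℕ) (i : ℕ) : ℕ :=
  if i = 0 then 0 else if i ≤ S.card then elt S i else n + 1

theorem elt_eq_orderEmb (S : Finset ℕ) (k : ℕ) (h : S.card = k) (i : ℕ) (hi : i < k) :
    elt S (i + 1) = S.orderEmbOfFin h ⟨i, hi⟩ := by
  rw [Finset.orderEmbOfFin_apply]
  simp [elt, h, hi]

/-- The defining conditions of an extended enumeration. -/
def Good (n k : ℕ) (f : ℕ → ℕ) : Prop :=
  f 0 = 0 ∧ f (k + 1) = n + 1 ∧ ∀ i ≤ k, f i < f (i + 1)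

theorem mem_Sset {n k : ℕ} {S : Finset ℕ} :
    S ∈ Sset n k ↔ (∀ x ∈ S, 1 ≤ x ∧ x ≤ n) ∧ S.card = k := by
  simp [Sset, Finset.mem_powersetCard, Finset.subset_iff]

theorem EE_good {n k : ℕ} {S : Finset ℕ} (hS : S ∈ Sset n k) : Good n k (EE n S) := by
  obtain ⟨h1, h2⟩ := mem_Sset.1 hS
  have hmem : ∀ i, i < k → elt S (i + 1) ∈ S := by
    intro i hi; rw [elt_eq_orderEmb S k h2 i hi]; exact Finset.orderEmbOfFin_mem _ _ _
  refine ⟨by simp [EE], by simp [EE, h2], ?_⟩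
  intro i hi
  unfold EE
  rcases Nat.eq_zero_or_pos i with rfl | hpos
  · by_cases hk : 1 ≤ k
    · have := h1 _ (hmem 0 (by omega)); simp only [zero_add] at this; simp [h2, hk]; omega
    · simp [h2, hk]
  · obtain ⟨j, rfl⟩ : ∃ j, i = j + 1 := ⟨i - 1, by omega⟩
    by_cases hk : j + 1 + 1 ≤ k
    · simp only [h2, hk, hi]
      simp only [Nat.add_eq_zero_iff, one_ne_zero, and_false, if_false, if_true]
      rw [elt_eq_orderEmb S k h2 j (by omega), elt_eq_orderEmb S k h2 (j + 1) (by omega)]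
      exact (S.orderEmbOfFin h2).strictMono (by simp)
    · have := h1 _ (hmem j (by omega))
      simp only [h2, hk, hi]
      simp; omega

theorem EE_image {n k : ℕ} {S : Finset ℕ} (hS : S ∈ Sset n k) :
    (Finset.Icc 1 k).image (EE n S) = S := by
  obtain ⟨h1, h2⟩ := mem_Sset.1 hS
  ext x
  simp only [Finset.mem_image, Finset.mem_Icc]
  constructor
  · rintro ⟨i, ⟨hi1, hi2⟩, rfl⟩
    obtain ⟨j, rfl⟩ : ∃ j, i = j + 1 := ⟨i - 1, by omega⟩
    simp only [EE, h2, hi2]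
    simp only [Nat.add_eq_zero_iff, one_ne_zero, and_false, if_false, if_true]
    rw [elt_eq_orderEmb S k h2 j (by omega)]; exact Finset.orderEmbOfFin_mem _ _ _
  · intro hx
    have : x ∈ Set.range (S.orderEmbOfFin h2) := by
      rw [Finset.range_orderEmbOfFin]; exact hx
    obtain ⟨⟨j, hj⟩, rfl⟩ := this
    refine ⟨j + 1, by omega, ?_⟩
    simp only [EE, h2, show j + 1 ≤ k by omega]
    simp [elt_eq_orderEmb S k h2 j hj]

theorem Good.lt {n k : ℕ} {f : ℕ → ℕ} (h : Good n k f) {i j : ℕ} (hij : i < j) (hj : j ≤ k + 1) :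
    f i < f j := by
  induction j with
  | zero => omega
  | succ j ih =>
    have h1 := h.2.2 j (by omega)
    rcases Nat.lt_succ_iff_lt_or_eq.1 hij with h2 | rfl
    · exact (ih h2 (by omega)).trans h1
    · exact h1

theorem Good.le_self {n k : ℕ} {f : ℕ → ℕ} (h : Good n k f) {i : ℕ} (hi : i ≤ k + 1) :
    i ≤ f i := by
  induction i with
  | zero => omega
  | succ j ih =>
    have h1 := h.2.2 j (by omega)
    have := ih (by omega)
    omega

theorem Good.mem {n k : ℕ} {f : ℕ → ℕ} (h : Good n k f) :
    (Finset.Icc 1 k).image f ∈ Sset n k := by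
  rw [mem_Sset]
  constructor
  · intro x hx
    simp only [Finset.mem_image, Finset.mem_Icc] at hx
    obtain ⟨i, hi, rfl⟩ := hx
    have h1 := h.lt (i := 0) (j := i) (by omega) (by omega)
    have h2 := h.lt (i := i) (j := k + 1) (by omega) (by omega)
    have := h.2.1
    omega
  · rw [Finset.card_image_of_injOn]
    · simp
    · intro i hi j hj hij
      simp only [Finset.coe_Icc, Set.mem_Icc] at hi hj
      rcases lt_trichotomy i j with h1 | h1 | h1
      · have := h.lt h1 (by omega); omega
      · exact h1
      · have := h.lt h1 (by omega); omega

theorem Good.EE_image {n k : ℕ} {f : ℕ → ℕ} (h : Good n k f) {i : ℕ} (hi : i ≤ k + 1) :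
    EE n ((Finset.Icc 1 k).image f) i = f i := by
  have hm := h.mem
  have hc := (mem_Sset.1 hm).2
  have hg := EE_good hm
  rcases Nat.eq_zero_or_pos i with rfl | hpos
  · rw [h.1, hg.1]
  rcases Nat.lt_or_ge k i with h1 | h1
  · have : i = k + 1 := by omega
    rw [this, h.2.1, hg.2.1]
  obtain ⟨j, rfl⟩ : ∃ j, i = j + 1 := ⟨i - 1, by omega⟩
  have hu := Finset.orderEmbOfFin_unique hc (f := fun i : Fin k => f (i + 1))
    (by intro x; simp only [Finset.mem_image, Finset.mem_Icc]; exact ⟨x + 1, by omega, rfl⟩)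
    (by intro a b hab; exact h.lt (by have : (a : ℕ) < b := hab
                                      omega) (by omega))
  have := congrFun hu ⟨j, by omega⟩
  simp only at this
  rw [this]
  simp only [EE, hc, h1]
  simp [elt_eq_orderEmb _ k hc j (by omega)]

theorem EE_inj {n k : ℕ} {S T : Finset ℕ} (hS : S ∈ Sset n k) (hT : T ∈ Sset n k)
    (h : ∀ i, 1 ≤ i → i ≤ k → EE n S i = EE n T i) : S = T := by
  rw [← EE_image hS, ← EE_image hT]
  apply Finset.image_congr
  intro i hi
  simp only [Finset.coe_Icc, Set.mem_Icc] at hi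
  exact h i hi.1 hi.2

theorem elt_EE {n k : ℕ} {S : Finset ℕ} (hS : S ∈ Sset n k) {i : ℕ} (h1 : 1 ≤ i) (h2 : i ≤ k) :
    elt S i = EE n S i := by
  have hc := (mem_Sset.1 hS).2
  simp [EE, hc, h2, show i ≠ 0 by omega]

theorem nxt_EE {n k : ℕ} {S : Finset ℕ} (hS : S ∈ Sset n k) {i : ℕ} (h1 : 1 ≤ i) (h2 : i ≤ k) :
    nxt n S i = EE n S (i + 1) := by
  have hc := (mem_Sset.1 hS).2
  by_cases h : i = k
  · simp [EE, nxt, hc, h]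
  · simp [EE, nxt, hc, h, show i + 1 ≤ k by omega]

theorem prv_EE {n k : ℕ} {S : Finset ℕ} (hS : S ∈ Sset n k) {i : ℕ} (h1 : 1 ≤ i) (h2 : i ≤ k) :
    prv S i = EE n S (i - 1) := by
  have hc := (mem_Sset.1 hS).2
  by_cases h : i = 1
  · simp [EE, prv, h]
  · simp [EE, prv, hc, h, show i - 1 ≤ k by omega, show i - 1 ≠ 0 by omega]

theorem mem_In {n k : ℕ} {S : Finset ℕ} (hS : S ∈ Sset n k) {i : ℕ} :
    i ∈ InS k S ↔ (1 ≤ i ∧ i ≤ k) ∧ EE n S i % 2 = k % 2 ∧ EE n S (i - 1) + 1 < EE n S i := by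
  simp only [InS, Finset.mem_filter, Finset.mem_Icc]
  refine and_congr_right fun h => ?_
  rw [elt_EE hS h.1 h.2, prv_EE hS h.1 h.2]

theorem mem_Out {n k : ℕ} {S : Finset ℕ} (hS : S ∈ Sset n k) {i : ℕ} :
    i ∈ OutS n k S ↔
      (1 ≤ i ∧ i ≤ k) ∧ ¬ (EE n S i % 2 = k % 2) ∧ EE n S i + 1 < EE n S (i + 1) := by
  simp only [OutS, Finset.mem_filter, Finset.mem_Icc]
  refine and_congr_right fun h => ?_
  rw [elt_EE hS h.1 h.2, nxt_EE hS h.1 h.2]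

theorem In_Out_disj {n k : ℕ} {S : Finset ℕ} (hS : S ∈ Sset n k) {i : ℕ}
    (h : i ∈ InS k S) : i ∉ OutS n k S := by
  rw [mem_Out hS]; rw [mem_In hS] at h; tauto

/-- Raise the elements with index in `B` by one. -/
noncomputable def upS (n k : ℕ) (S B : Finset ℕ) : Finset ℕ :=
  (Finset.Icc 1 k).image fun i => EE n S i + if i ∈ B then 1 else 0

/-- Lower the elements with index in `B` by one. -/
noncomputable def downS (n k : ℕ) (S B : Finset ℕ) : Finset ℕ :=
  (Finset.Icc 1 k).image fun i => EE n S i - if i ∈ B then 1 else 0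

section up
variable {n k : ℕ} {S B : Finset ℕ}

theorem up_good (hS : S ∈ Sset n k) (hB : B ⊆ OutS n k S) :
    Good n k (fun i => EE n S i + if i ∈ B then 1 else 0) := by
  have hg := EE_good hS
  have hB' : ∀ i ∈ B, _ := fun i hi => (mem_Out hS).1 (hB hi)
  refine ⟨?_, ?_, ?_⟩
  · have : 0 ∉ B := fun h => by have := hB' _ h; omega
    simp [this, hg.1]
  · have : k + 1 ∉ B := fun h => by have := hB' _ h; omega
    simp [this, hg.2.1]
  · intro i hi
    have := hg.2.2 i hi
    dsimp only
    split_ifs with h1 h2 h2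
    · omega
    · have := hB' _ h1; omega
    · omega
    · omega

theorem up_mem (hS : S ∈ Sset n k) (hB : B ⊆ OutS n k S) : upS n k S B ∈ Sset n k :=
  (up_good hS hB).mem

theorem up_EE (hS : S ∈ Sset n k) (hB : B ⊆ OutS n k S) {i : ℕ} (hi : i ≤ k + 1) :
    EE n (upS n k S B) i = EE n S i + if i ∈ B then 1 else 0 :=
  (up_good hS hB).EE_image hi

theorem up_In (hS : S ∈ Sset n k) (hB : B ⊆ OutS n k S) :
    InS k (upS n k S B) = InS k S ∪ B := by
  have hB' : ∀ i ∈ B, _ := fun i hi => (mem_Out hS).1 (hB hi)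
  ext i
  rw [Finset.mem_union, mem_In (up_mem hS hB), mem_In hS]
  by_cases hi : 1 ≤ i ∧ i ≤ k
  · rw [up_EE hS hB (by omega), up_EE hS hB (by omega)]
    have h0 := (EE_good hS).2.2 (i - 1) (by omega)
    have h1 := (EE_good hS).2.2 i (by omega)
    rw [show i - 1 + 1 = i by omega] at h0
    by_cases h2 : i ∈ B
    · have := hB' _ h2
      by_cases h3 : i - 1 ∈ B
      · have := hB' _ h3
        rw [show i - 1 + 1 = i by omega] at this
        simp only [h2, h3, if_true, or_true, iff_true]; omega
      · simp only [h2, h3, if_true, if_false, or_true, iff_true]; omega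
    · by_cases h3 : i - 1 ∈ B
      · have := hB' _ h3
        rw [show i - 1 + 1 = i by omega] at this
        simp only [h2, h3, if_true, if_false, or_false]; omega
      · simp only [h2, h3, if_false, or_false]; omega
  · have : i ∉ B := fun h => hi (hB' _ h).1
    simp [hi, this]

theorem up_Out (hS : S ∈ Sset n k) (hB : B ⊆ OutS n k S) :
    OutS n k (upS n k S B) = OutS n k S \ B := by
  have hB' : ∀ i ∈ B, _ := fun i hi => (mem_Out hS).1 (hB hi)
  ext i
  rw [Finset.mem_sdiff, mem_Out (up_mem hS hB), mem_Out hS]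
  by_cases hi : 1 ≤ i ∧ i ≤ k
  · rw [up_EE hS hB (by omega), up_EE hS hB (by omega)]
    have h1 := (EE_good hS).2.2 i (by omega)
    by_cases h2 : i ∈ B
    · have := hB' _ h2
      simp only [h2, if_true, not_true, and_false, iff_false]; omega
    · by_cases h3 : i + 1 ∈ B
      · have := hB' _ h3
        simp only [h2, h3, if_true, if_false, not_false_eq_true, and_true]; omega
      · simp only [h2, h3, if_false, not_false_eq_true, and_true]; omega
  · simp [hi]

theorem down_good (hS : S ∈ Sset n k) (hB : B ⊆ InS k S) :
    Good n k (fun i => EE n S i - if i ∈ B then 1 else 0) := by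
  have hg := EE_good hS
  have hB' : ∀ i ∈ B, _ := fun i hi => (mem_In hS).1 (hB hi)
  refine ⟨?_, ?_, ?_⟩
  · simp [hg.1]
  · have : k + 1 ∉ B := fun h => by have := hB' _ h; omega
    simp [this, hg.2.1]
  · intro i hi
    have := hg.2.2 i hi
    dsimp only
    split_ifs with h1 h2 h2
    · have := hB' _ h1; omega
    · omega
    · have := hB' _ h2
      rw [show i + 1 - 1 = i by omega] at this; omega
    · omega

theorem down_mem (hS : S ∈ Sset n k) (hB : B ⊆ InS k S) : downS n k S B ∈ Sset n k :=
  (down_good hS hB).mem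

theorem down_EE (hS : S ∈ Sset n k) (hB : B ⊆ InS k S) {i : ℕ} (hi : i ≤ k + 1) :
    EE n (downS n k S B) i = EE n S i - if i ∈ B then 1 else 0 :=
  (down_good hS hB).EE_image hi

theorem down_sub_Out (hS : S ∈ Sset n k) (hB : B ⊆ InS k S) :
    B ⊆ OutS n k (downS n k S B) := by
  have hB' : ∀ i ∈ B, _ := fun i hi => (mem_In hS).1 (hB hi)
  intro i hi
  have h := hB' i hi
  have h1 := (EE_good hS).2.2 i (by omega)
  rw [mem_Out (down_mem hS hB), down_EE hS hB (by omega), down_EE hS hB (by omega)]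
  by_cases h3 : i + 1 ∈ B
  · have := hB' _ h3
    rw [show i + 1 - 1 = i by omega] at this
    simp only [hi, h3, if_true]; omega
  · simp only [hi, h3, if_true, if_false]; omega

theorem up_down (hS : S ∈ Sset n k) (hB : B ⊆ InS k S) :
    upS n k (downS n k S B) B = S := by
  apply EE_inj (n := n) (up_mem (down_mem hS hB) (down_sub_Out hS hB)) hS
  intro i h1 h2
  rw [up_EE (down_mem hS hB) (down_sub_Out hS hB) (by omega), down_EE hS hB (by omega)]
  have := (EE_good hS).le_self (i := i) (by omega)
  split_ifs <;> omega

theorem up_inj {T : Finset ℕ} (hS : S ∈ Sset n k) (hB : B ⊆ OutS n k S) (hT : T ∈ Sset n k)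
    (hB' : B ⊆ OutS n k T) (h : upS n k S B = upS n k T B) : S = T := by
  apply EE_inj (n := n) hS hT
  intro i h1 h2
  have e1 := up_EE hS hB (i := i) (by omega)
  have e2 := up_EE hT hB' (i := i) (by omega)
  rw [h] at e1
  omega

theorem up_up {B' : Finset ℕ} (hS : S ∈ Sset n k) (hB : B ⊆ OutS n k S)
    (hB' : B' ⊆ OutS n k S) (hd : Disjoint B B') :
    upS n k (upS n k S B) B' = upS n k S (B ∪ B') := by
  have h3 : B' ⊆ OutS n k (upS n k S B) := by
    rw [up_Out hS hB, Finset.subset_sdiff]; exact ⟨hB', hd.symm⟩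
  have h4 := Finset.union_subset hB hB'
  apply EE_inj (n := n) (up_mem (up_mem hS hB) h3) (up_mem hS h4)
  intro i h1 h2
  rw [up_EE (up_mem hS hB) h3 (by omega), up_EE hS hB (by omega), up_EE hS h4 (by omega)]
  have : i ∈ B → i ∉ B' := fun h => Finset.disjoint_left.1 hd h
  simp only [Finset.mem_union]
  by_cases h5 : i ∈ B <;> by_cases h6 : i ∈ B' <;> simp_all

theorem up_B_inj {B' : Finset ℕ} (hS : S ∈ Sset n k) (hB : B ⊆ OutS n k S)
    (hB' : B' ⊆ OutS n k S) (h : upS n k S B = upS n k S B') : B = B' := by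
  have h1 := up_Out hS hB
  have h2 := up_Out hS hB'
  rw [h, h2] at h1
  rw [← Finset.sdiff_sdiff_eq_self hB, ← h1, Finset.sdiff_sdiff_eq_self hB']

theorem dr_EE (hS : S ∈ Sset n k) {r : ℕ} (hr : 1 ≤ r) :
    (dr S r : ℤ) = ∑ i ∈ Finset.Icc r k, ((EE n S i : ℤ) - i) := by
  have hc := (mem_Sset.1 hS).2
  unfold dr
  rw [hc]
  push_cast
  apply Finset.sum_congr rfl
  intro i hi
  rw [Finset.mem_Icc] at hi
  rw [elt_EE hS (by omega) hi.2]
  have := (EE_good hS).le_self (i := i) (by omega)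
  omega

theorem up_dr (hS : S ∈ Sset n k) (hB : B ⊆ OutS n k S) {r : ℕ} (hr : 1 ≤ r) :
    dr (upS n k S B) r = dr S r + (B.filter (r ≤ ·)).card := by
  zify
  rw [dr_EE (up_mem hS hB) hr, dr_EE hS hr]
  have : ∀ i ∈ Finset.Icc r k, ((EE n (upS n k S B) i : ℤ) - i)
      = ((EE n S i : ℤ) - i) + if i ∈ B then 1 else 0 := by
    intro i hi
    rw [Finset.mem_Icc] at hi
    rw [up_EE hS hB (by omega)]
    push_cast; ring
  rw [Finset.sum_congr rfl this, Finset.sum_add_distrib]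
  congr 1
  rw [Finset.sum_ite_mem, Finset.sum_const, nsmul_eq_mul, mul_one]
  congr 2
  ext i
  simp only [Finset.mem_inter, Finset.mem_Icc, Finset.mem_filter, Nat.cast_le]
  constructor
  · tauto
  · rintro ⟨h1, h2⟩
    have := (mem_Out hS).1 (hB h1)
    exact ⟨⟨h2, this.1.2⟩, h1⟩

theorem up_dS (hS : S ∈ Sset n k) (hB : B ⊆ OutS n k S) :
    dS (upS n k S B) = dS S + B.card := by
  unfold dS
  rw [up_dr hS hB le_rfl, Finset.filter_true_of_mem]
  intro i hi
  exact ((mem_Out hS).1 (hB hi)).1.1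

theorem Sr_eq_up (hS : S ∈ Sset n k) {r : ℕ} (hr : r ∈ OutS n k S) :
    Sr S r = upS n k S {r} := by
  have h := (mem_Out hS).1 hr
  have hg := EE_good hS
  unfold Sr
  rw [elt_EE hS h.1.1 h.1.2]
  conv_lhs => rw [← EE_image hS]
  unfold upS
  rw [EE_image hS]
  ext x
  simp only [Finset.mem_insert, Finset.mem_erase, Finset.mem_image, Finset.mem_singleton]
  constructor
  · rintro (rfl | ⟨h1, h2⟩)
    · exact ⟨r, by simpa using h.1, by simp⟩
    · rw [← EE_image hS, Finset.mem_image] at h2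
      obtain ⟨i, hi, rfl⟩ := h2
      refine ⟨i, hi, ?_⟩
      rw [if_neg]; · simp
      rintro rfl; exact h1 rfl
  · rintro ⟨i, hi, rfl⟩
    by_cases hir : i = r
    · left; simp [hir]
    · right
      simp only [hir, if_false, add_zero]
      constructor
      · rw [Finset.mem_Icc] at hi
        rcases lt_or_gt_of_ne hir with h1 | h1
        · have := hg.lt h1 (by omega); omega
        · have := hg.lt h1 (by omega); omega
      · have h5 := Finset.mem_image_of_mem (EE n S) hi
        rwa [EE_image hS] at h5

end up
end comb

section match_part

/-- The pivot: the largest active index (`0` if there is none). -/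
noncomputable def piv (n k : ℕ) (S : Finset ℕ) : ℕ := (InS k S ∪ OutS n k S).sup id

theorem piv_mem {n k : ℕ} {S : Finset ℕ} (h : (InS k S ∪ OutS n k S).Nonempty) :
    piv n k S ∈ InS k S ∪ OutS n k S := by
  obtain ⟨i, hi, h2⟩ := Finset.exists_mem_eq_sup _ h id
  unfold piv
  rw [h2]; exact hi

theorem up_act {n k : ℕ} {S B : Finset ℕ} (hS : S ∈ Sset n k) (hB : B ⊆ OutS n k S) :
    InS k (upS n k S B) ∪ OutS n k (upS n k S B) = InS k S ∪ OutS n k S := by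
  rw [up_In hS hB, up_Out hS hB, Finset.union_assoc, Finset.union_sdiff_of_subset hB]

theorem up_piv {n k : ℕ} {S B : Finset ℕ} (hS : S ∈ Sset n k) (hB : B ⊆ OutS n k S) :
    piv n k (upS n k S B) = piv n k S := by
  unfold piv; rw [up_act hS hB]

/-- The subsets whose pivot can be raised. -/
noncomputable def lowIdx (n k : ℕ) : Finset (Finset ℕ) :=
  (Sset n k).filter fun S => piv n k S ∈ OutS n k S

theorem down_Out {n k : ℕ} {T B : Finset ℕ} (hT : T ∈ Sset n k) (hO : OutS n k T = ∅)
    (hB : B ⊆ InS k T) : OutS n k (downS n k T B) = B := by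
  have h := up_Out (down_mem hT hB) (down_sub_Out hT hB)
  rw [up_down hT hB, hO] at h
  exact Finset.Subset.antisymm (Finset.sdiff_eq_empty_iff_subset.1 h.symm) (down_sub_Out hT hB)

theorem down_piv {n k : ℕ} {T B : Finset ℕ} (hT : T ∈ Sset n k)
    (hB : B ⊆ InS k T) : piv n k (downS n k T B) = piv n k T := by
  have h := up_piv (down_mem hT hB) (down_sub_Out hT hB)
  rw [up_down hT hB] at h
  exact h.symm

/-- Label of a low subset: its top and the number of remaining raisable indices. -/
noncomputable def lowLab (n k : ℕ) (S : Finset ℕ) : Finset ℕ × ℕ :=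
  (upS n k S (OutS n k S), (OutS n k S).card - 1)

theorem fiber_card_cone (n k : ℕ) (T : Finset ℕ) (a : ℕ)
    (hT : T ∈ Sset n k) (hO : OutS n k T = ∅) (ha : a < (InS k T).card) :
    ((coneIdx n k).filter fun p => (p.1, p.2.1) = (T, a)).card
      = Nat.choose ((InS k T).card - 1) a := by
  have hIk : (InS k T).card ≤ k := by
    have := Finset.card_filter_le (Finset.Icc 1 k)
      (fun i => elt T i % 2 = k % 2 ∧ prv T i + 1 < elt T i)
    simpa [InS] using this
  have : ((coneIdx n k).filter fun p => (p.1, p.2.1) = (T, a))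
      = (Finset.range (Nat.choose ((InS k T).card - 1) a)).image (fun c => (T, a, c)) := by
    ext ⟨T', a', c⟩
    simp only [coneIdx, Finset.mem_filter, Finset.mem_product, Finset.mem_range, Finset.mem_image,
      Prod.mk.injEq]
    constructor
    · rintro ⟨⟨_, h1, h2⟩, rfl, rfl⟩
      exact ⟨c, h2, rfl, rfl, rfl⟩
    · rintro ⟨c', hc, rfl, rfl, rfl⟩
      refine ⟨⟨⟨⟨hT, hO, ?_⟩, by omega, ?_⟩, ha, hc⟩, rfl, rfl⟩
      · rintro h; rw [h] at ha; simp at ha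
      · refine hc.trans_le ((Nat.choose_le_two_pow _ _).trans ?_)
        exact Nat.pow_le_pow_right (by norm_num) (by omega)
  rw [this, Finset.card_image_of_injective, Finset.card_range]
  intro c c' h
  simpa using h

theorem fiber_card_low (n k : ℕ) (T : Finset ℕ) (a : ℕ)
    (hT : T ∈ Sset n k) (hO : OutS n k T = ∅) (ha : a < (InS k T).card) :
    ((lowIdx n k).filter fun S => lowLab n k S = (T, a)).card
      = Nat.choose ((InS k T).card - 1) a := by
  have hne : (InS k T ∪ OutS n k T).Nonempty := by
    rw [hO, Finset.union_empty, ← Finset.card_pos]; omega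
  have hp : piv n k T ∈ InS k T := by
    have := piv_mem hne
    rwa [hO, Finset.union_empty] at this
  rw [← Finset.card_erase_of_mem hp, ← Finset.card_powersetCard]
  symm
  have hsub : ∀ B, B ∈ Finset.powersetCard a ((InS k T).erase (piv n k T)) →
      piv n k T ∉ B ∧ insert (piv n k T) B ⊆ InS k T ∧ B.card = a := by
    intro B hB
    rw [Finset.mem_powersetCard] at hB
    refine ⟨fun h => by simpa using hB.1 h, ?_, hB.2⟩
    rw [Finset.insert_subset_iff]
    exact ⟨hp, hB.1.trans (Finset.erase_subset _ _)⟩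
  refine Finset.card_bij' (fun B _ => downS n k T (insert (piv n k T) B))
    (fun S _ => (OutS n k S).erase (piv n k T)) ?_ ?_ ?_ ?_
  · intro B hB
    obtain ⟨h1, h2, h3⟩ := hsub B hB
    rw [Finset.mem_filter, lowIdx, Finset.mem_filter, lowLab]
    rw [down_Out hT hO h2, down_piv hT h2, up_down hT h2, Finset.card_insert_of_notMem h1, h3]
    exact ⟨⟨down_mem hT h2, by simp⟩, rfl⟩
  · intro S hS
    simp only [Finset.mem_filter, lowIdx, lowLab, Prod.mk.injEq] at hS
    obtain ⟨⟨hS1, hS2⟩, rfl, hS4⟩ := hS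
    rw [up_piv hS1 subset_rfl, up_In hS1 subset_rfl, Finset.mem_powersetCard,
      Finset.card_erase_of_mem hS2]
    exact ⟨Finset.erase_subset_erase _ Finset.subset_union_right, hS4⟩
  · intro B hB
    obtain ⟨h1, h2, h3⟩ := hsub B hB
    rw [down_Out hT hO h2, Finset.erase_insert h1]
  · intro S hS
    simp only [Finset.mem_filter, lowIdx, lowLab, Prod.mk.injEq] at hS
    obtain ⟨⟨hS1, hS2⟩, rfl, hS4⟩ := hS
    rw [up_piv hS1 subset_rfl, Finset.insert_erase hS2]
    have h5 : OutS n k S ⊆ InS k (upS n k S (OutS n k S)) := by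
      rw [up_In hS1 subset_rfl]; exact Finset.subset_union_right
    have hT' := up_mem hS1 (subset_rfl : OutS n k S ⊆ OutS n k S)
    exact up_inj (down_mem hT' h5) (down_sub_Out hT' h5) hS1 subset_rfl (up_down hT' h5)

theorem fiber_card (n k : ℕ) (c : Finset ℕ × ℕ) :
    ((coneIdx n k).filter fun p => (p.1, p.2.1) = c).card
      = ((lowIdx n k).filter fun S => lowLab n k S = c).card := by
  obtain ⟨T, a⟩ := c
  by_cases h : T ∈ Sset n k ∧ OutS n k T = ∅ ∧ a < (InS k T).card
  · rw [fiber_card_cone n k T a h.1 h.2.1 h.2.2, fiber_card_low n k T a h.1 h.2.1 h.2.2]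
  · rw [Finset.filter_false_of_mem (s := coneIdx n k), Finset.filter_false_of_mem (s := lowIdx n k)]
    · rfl
    · intro S hS hl
      apply h
      simp only [Finset.mem_filter, lowIdx, lowLab, Prod.mk.injEq] at hS hl
      obtain ⟨hS1, hS2⟩ := hS
      obtain ⟨rfl, rfl⟩ := hl
      refine ⟨up_mem hS1 subset_rfl, by rw [up_Out hS1 subset_rfl, Finset.sdiff_self], ?_⟩
      rw [up_In hS1 subset_rfl]
      have h1 := Finset.card_pos.2 ⟨_, hS2⟩
      have h2 := Finset.card_le_card (Finset.subset_union_right : OutS n k S ⊆ InS k S ∪ OutS n k S)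
      omega
    · rintro ⟨T', a', c⟩ hp hl
      apply h
      simp only [coneIdx, Finset.mem_filter, Finset.mem_product, Prod.mk.injEq] at hp hl
      obtain ⟨rfl, rfl⟩ := hl
      exact ⟨hp.1.1.1, hp.1.1.2.1, hp.2.1⟩

theorem exists_cone_equiv (n k : ℕ) : ∃ σ : ↥(coneIdx n k) ≃ ↥(lowIdx n k),
    ∀ p, (dS p.1.1 : ℤ) - (p.1.2.1 : ℤ) - 1 = dS (σ p).1 := by
  have E : ∀ c : Finset ℕ × ℕ,
      {p : ↥(coneIdx n k) // (p.1.1, p.1.2.1) = c} ≃ {S : ↥(lowIdx n k) // lowLab n k S.1 = c} := by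
    intro c
    have e1 : {p : ↥(coneIdx n k) // (p.1.1, p.1.2.1) = c} ≃
        ↥((coneIdx n k).filter fun p => (p.1, p.2.1) = c) :=
      (Equiv.subtypeSubtypeEquivSubtypeInter (fun p => p ∈ coneIdx n k)
        (fun p => (p.1, p.2.1) = c)).trans
        (Equiv.subtypeEquivRight (fun p => by rw [Finset.mem_filter]))
    have e2 : {S : ↥(lowIdx n k) // lowLab n k S.1 = c} ≃
        ↥((lowIdx n k).filter fun S => lowLab n k S = c) :=
      (Equiv.subtypeSubtypeEquivSubtypeInter (fun p => p ∈ lowIdx n k)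
        (fun S => lowLab n k S = c)).trans
        (Equiv.subtypeEquivRight (fun p => by rw [Finset.mem_filter]))
    exact e1.trans ((Finset.equivOfCardEq (fiber_card n k c)).trans e2.symm)
  refine ⟨Equiv.ofFiberEquiv E, ?_⟩
  intro p
  have h := Equiv.ofFiberEquiv_map E p
  generalize Equiv.ofFiberEquiv E p = S at h
  obtain ⟨S, hS⟩ := S
  simp only [Finset.mem_filter, lowIdx, lowLab, Prod.mk.injEq] at hS h
  obtain ⟨hS1, hS2⟩ := hS
  rw [← h.1, ← h.2, up_dS hS1 subset_rfl]
  have h1 := Finset.card_pos.2 ⟨_, hS2⟩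
  push_cast [h1]
  omega

/-- The partition of `{n;k}` into unmatched, lower and upper subsets. -/
noncomputable def betaFun (n k : ℕ) : ↥(freeIdx n k) ⊕ ↥(lowIdx n k) × Fin 2 → ↥(Sset n k)
  | .inl S => ⟨S.1, (Finset.mem_filter.1 S.2).1⟩
  | .inr (S, 0) => ⟨S.1, (Finset.mem_filter.1 S.2).1⟩
  | .inr (S, 1) => ⟨upS n k S.1 {piv n k S.1}, up_mem (Finset.mem_filter.1 S.2).1
      (Finset.singleton_subset_iff.2 (Finset.mem_filter.1 S.2).2)⟩

theorem upper_spec {n k : ℕ} {S : Finset ℕ} (hS : S ∈ Sset n k) (hp : piv n k S ∈ OutS n k S) :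
    piv n k (upS n k S {piv n k S}) = piv n k S ∧
    piv n k S ∈ InS k (upS n k S {piv n k S}) := by
  have hB := Finset.singleton_subset_iff.2 hp
  refine ⟨up_piv hS hB, ?_⟩
  rw [up_In hS hB]; simp

theorem upper_inj {n k : ℕ} {S T : Finset ℕ} (hS : S ∈ Sset n k) (hp : piv n k S ∈ OutS n k S)
    (hT : T ∈ Sset n k) (hpT : piv n k T ∈ OutS n k T)
    (h : upS n k S {piv n k S} = upS n k T {piv n k T}) : S = T := by
  have h1 := (upper_spec hS hp).1
  have h2 := (upper_spec hT hpT).1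
  rw [h, h2] at h1
  rw [h1] at h hpT
  exact up_inj hS (Finset.singleton_subset_iff.2 hp) hT (Finset.singleton_subset_iff.2 hpT) h

theorem beta_bij (n k : ℕ) : Function.Bijective (betaFun n k) := by
  constructor
  · have key1 : ∀ (S : ↥(freeIdx n k)) (T : Finset ℕ), piv n k T ∈ InS k T ∪ OutS n k T → S.1 ≠ T := by
      rintro ⟨S, hS⟩ T hT rfl
      simp only [freeIdx, Finset.mem_filter] at hS
      rw [hS.2.1, hS.2.2] at hT
      simp at hT
    have key2 : ∀ (S T : ↥(lowIdx n k)), S.1 ≠ upS n k T.1 {piv n k T.1} := by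
      rintro ⟨S, hS⟩ ⟨T, hT⟩ h
      simp only [lowIdx, Finset.mem_filter] at hS hT h
      have h1 := upper_spec hT.1 hT.2
      rw [← h] at h1
      rw [← h1.1] at h1
      exact In_Out_disj hS.1 h1.2 hS.2
    have kl : ∀ S : ↥(lowIdx n k), piv n k S.1 ∈ InS k S.1 ∪ OutS n k S.1 := by
      rintro ⟨S, hS⟩
      simp only [lowIdx, Finset.mem_filter] at hS
      exact Finset.mem_union_right _ hS.2
    have ku : ∀ S : ↥(lowIdx n k), piv n k (upS n k S.1 {piv n k S.1}) ∈
        InS k (upS n k S.1 {piv n k S.1}) ∪ OutS n k (upS n k S.1 {piv n k S.1}) := by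
      rintro ⟨S, hS⟩
      simp only [lowIdx, Finset.mem_filter] at hS
      have h1 := upper_spec hS.1 hS.2
      rw [h1.1]
      exact Finset.mem_union_left _ h1.2
    rintro (S | ⟨S, i⟩) (T | ⟨T, j⟩) h
    · have := congrArg Subtype.val h
      simp only [betaFun] at this
      rw [Subtype.ext this]
    · exfalso
      have := congrArg Subtype.val h
      obtain rfl | rfl : j = 0 ∨ j = 1 := by omega
      · exact key1 S _ (kl T) this
      · exact key1 S _ (ku T) this
    · exfalso
      have := (congrArg Subtype.val h).symm
      obtain rfl | rfl : i = 0 ∨ i = 1 := by omega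
      · exact key1 T _ (kl S) this
      · exact key1 T _ (ku S) this
    · have := congrArg Subtype.val h
      obtain rfl | rfl : i = 0 ∨ i = 1 := by omega
      · obtain rfl | rfl : j = 0 ∨ j = 1 := by omega
        · have h2 : S = T := Subtype.ext this
          rw [h2]
        · exact absurd this (key2 S T)
      · obtain rfl | rfl : j = 0 ∨ j = 1 := by omega
        · exact absurd this.symm (key2 T S)
        · have hS := Finset.mem_filter.1 S.2
          have hT := Finset.mem_filter.1 T.2
          have h2 : S = T := Subtype.ext (upper_inj hS.1 hS.2 hT.1 hT.2 this)
          rw [h2]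
  · rintro ⟨S, hS⟩
    by_cases hne : (InS k S ∪ OutS n k S).Nonempty
    · rcases Finset.mem_union.1 (piv_mem hne) with h | h
      · have hB := Finset.singleton_subset_iff.2 h
        have hp := down_piv hS hB
        refine ⟨.inr (⟨downS n k S {piv n k S}, Finset.mem_filter.2 ⟨down_mem hS hB, ?_⟩⟩, 1), ?_⟩
        · rw [hp]; exact down_sub_Out hS hB (by simp)
        · apply Subtype.ext
          simp only [betaFun]
          rw [hp, up_down hS hB]
      · exact ⟨.inr (⟨S, Finset.mem_filter.2 ⟨hS, h⟩⟩, 0), rfl⟩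
    · rw [Finset.not_nonempty_iff_eq_empty, Finset.union_eq_empty] at hne
      exact ⟨.inl ⟨S, Finset.mem_filter.2 ⟨hS, hne⟩⟩, rfl⟩

/-- The differential divided by two. -/
noncomputable def halfD (n k : ℕ) (R : Type*) [CommRing R] :
    Matrix ↥(Sset n k) ↥(Sset n k) R :=
  fun T S => ∑ r ∈ OutS n k S.1, if T.1 = upS n k S.1 {r} then (-1 : R) ^ dr S.1 r else 0

theorem schubD_eq (n k : ℕ) (R : Type*) [CommRing R] (T S : ↥(Sset n k)) :
    schubD n k R T S = 2 * halfD n k R T S := by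
  obtain ⟨S, hS⟩ := S
  simp only [schubD, schubCoeff, halfD]
  rw [Finset.mul_sum]
  have hsub : OutS n k S ⊆ Finset.Icc 1 k := Finset.filter_subset _ _
  rw [← Finset.sum_subset hsub]
  · apply Finset.sum_congr rfl
    intro r hr
    have h := (mem_Out hS).1 hr
    rw [Sr_eq_up hS hr, nxt_EE hS h.1.1 h.1.2, elt_EE hS h.1.1 h.1.2]
    have h1 : 1 < EE n S (r + 1) - EE n S r := by omega
    have h2 : Odd ((k : ℤ) - EE n S r) := by rw [Int.odd_iff]; omega
    simp only [h1, h2, true_and]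
    split_ifs <;> ring
  · intro r hr hr2
    rw [if_neg]
    rintro ⟨h1, h2, -⟩
    apply hr2
    rw [Finset.mem_Icc] at hr
    rw [mem_Out hS]
    rw [nxt_EE hS hr.1 hr.2, elt_EE hS hr.1 hr.2] at h1
    rw [elt_EE hS hr.1 hr.2, Int.odd_iff] at h2
    omega

theorem halfD_sq (n k : ℕ) (R : Type*) [CommRing R] (U S : ↥(Sset n k)) :
    ∑ T, halfD n k R U T * halfD n k R T S = 0 := by
  obtain ⟨S, hS⟩ := S
  obtain ⟨U, hU⟩ := U
  have hsing : ∀ {r}, r ∈ OutS n k S → {r} ⊆ OutS n k S := fun h => Finset.singleton_subset_iff.2 h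
  have h1 : ∑ T, halfD n k R ⟨U, hU⟩ T * halfD n k R T ⟨S, hS⟩
      = ∑ r ∈ OutS n k S, ∑ r' ∈ (OutS n k S).erase r,
        if U = upS n k S ({r} ∪ {r'}) then
          (-1 : R) ^ (dr (upS n k S {r}) r' + dr S r) else 0 := by
    have : ∀ T : ↥(Sset n k), halfD n k R ⟨U, hU⟩ T * halfD n k R T ⟨S, hS⟩
        = ∑ r ∈ OutS n k S, if T.1 = upS n k S {r} then
            halfD n k R ⟨U, hU⟩ T * (-1 : R) ^ dr S r else 0 := by
      intro T
      conv_lhs => rw [halfD.eq_def n k R T, Finset.mul_sum]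
      apply Finset.sum_congr rfl
      intro r _
      split_ifs <;> simp
    rw [Finset.sum_congr rfl (fun T _ => this T), Finset.sum_comm]
    apply Finset.sum_congr rfl
    intro r hr
    have hm := up_mem hS (hsing hr)
    rw [Finset.sum_eq_single (⟨upS n k S {r}, hm⟩ : ↥(Sset n k))]
    · rw [if_pos rfl]
      simp only [halfD]
      rw [up_Out hS (hsing hr), Finset.sdiff_singleton_eq_erase, Finset.sum_mul]
      apply Finset.sum_congr rfl
      intro r' hr'
      rw [Finset.mem_erase] at hr'
      rw [up_up hS (hsing hr) (hsing hr'.2) (by simpa using hr'.1.symm)]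
      split_ifs <;> simp [pow_add]
    · intro T _ hT
      rw [if_neg]
      intro h; exact hT (Subtype.ext h)
    · intro h; exact absurd (Finset.mem_univ _) h
  rw [h1, Finset.sum_sigma']
  apply Finset.sum_involution (fun x _ => ⟨x.2, x.1⟩)
  · rintro ⟨r, r'⟩ h
    simp only [Finset.mem_sigma, Finset.mem_erase] at h
    obtain ⟨hr, hne, hr'⟩ := h
    rw [Finset.union_comm {r'} {r}]
    by_cases hu : U = upS n k S ({r} ∪ {r'})
    · simp only [← hu, if_true]
      have b1 := ((mem_Out hS).1 hr).1.1
      have b2 := ((mem_Out hS).1 hr').1.1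
      rw [up_dr hS (hsing hr) b2, up_dr hS (hsing hr') b1]
      simp only [Finset.filter_singleton]
      rcases lt_or_gt_of_ne hne with h | h
      · rw [if_pos h.le, if_neg (by omega)]
        simp only [Finset.card_singleton, Finset.card_empty, pow_add]; ring
      · rw [if_neg (by omega), if_pos h.le]
        simp only [Finset.card_singleton, Finset.card_empty, pow_add]; ring
    · simp only [hu, if_false, add_zero]
  · rintro ⟨r, r'⟩ h _ h2
    simp only [Finset.mem_sigma, Finset.mem_erase] at h
    simp only [Sigma.mk.injEq, heq_eq_eq] at h2
    exact h.2.1 h2.1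
  · rintro ⟨r, r'⟩ h
    rfl
  · rintro ⟨r, r'⟩ h
    simp only [Finset.mem_sigma, Finset.mem_erase] at h ⊢
    exact ⟨h.2.2, h.2.1.symm, h.1⟩

theorem halfD_ne {n k : ℕ} {R : Type*} [CommRing R] {T S : ↥(Sset n k)}
    (h : halfD n k R T S ≠ 0) : ∃ r ∈ OutS n k S.1, T.1 = upS n k S.1 {r} := by
  obtain ⟨r, hr, h2⟩ := Finset.exists_ne_zero_of_sum_ne_zero h
  refine ⟨r, hr, ?_⟩
  by_contra h3
  exact h2 (if_neg h3)

end match_part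

/-- the Schubert cochain complex over `R` is isomorphic, as a cochain complex of
`R`-modules, to the direct sum of `R[d(S)]` for `S` with `In(S) = ∅ = Out(S)`, and, for each
`S` with `Out(S) = ∅` and `In(S) ≠ ∅` and each `0 ≤ a < card In(S)`, of
`binom(card In(S) − 1, a)` copies of `R →2→ R` in degrees `d(S) − a − 1`, `d(S) − a`. -/
theorem stmt13 (n k : ℕ) (hk : k ≤ n) (R : Type*) [CommRing R] :
    CxIso R (schubD n k R) (fun S => (dS S.1 : ℤ))
      (coneSumD13 n k R)
      (Sum.elim (fun S => (dS S.1 : ℤ))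
        (fun p => (dS p.1.1.1 : ℤ) - (p.1.1.2.1 : ℤ) - 1 + ((p.2 : ℕ) : ℤ))) := by

  obtain ⟨σ, hσ⟩ := exists_cone_equiv n k
  let β : ↥(freeIdx n k) ⊕ ↥(coneIdx n k) × Fin 2 ≃ ↥(Sset n k) :=
    (Equiv.sumCongr (Equiv.refl _) (Equiv.prodCongr σ (Equiv.refl _))).trans
      (Equiv.ofBijective _ (beta_bij n k))
  have hβF : ∀ f, (β (.inl f)).1 = f.1 := fun f => rfl
  have hβ0 : ∀ c, (β (.inr (c, 0))).1 = (σ c).1 := fun c => rfl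
  have hβ1 : ∀ c, (β (.inr (c, 1))).1 = upS n k (σ c).1 {piv n k (σ c).1} := fun c => rfl
  have hl : ∀ c, (σ c).1 ∈ Sset n k ∧ piv n k (σ c).1 ∈ OutS n k (σ c).1 :=
    fun c => Finset.mem_filter.1 (σ c).2
  have hu1 : ∀ c, (dS (β (.inr (c, 1))).1 : ℤ) = dS (σ c).1 + 1 := by
    intro c
    rw [hβ1, up_dS (hl c).1 (Finset.singleton_subset_iff.2 (hl c).2)]
    simp
  refine generic_split R (halfD n k R) (schubD n k R) (schubD_eq n k R) (halfD_sq n k R)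
    _ ?_ β (fun c => (-1) ^ dr (σ c).1 (piv n k (σ c).1)) ?_ ?_ ?_ ?_ _ ?_ _ ?_
  · intro T S h
    obtain ⟨r, hr, h2⟩ := halfD_ne h
    rw [h2, up_dS S.2 (Finset.singleton_subset_iff.2 hr)]
    simp
  · intro c
    rw [← pow_add, Even.neg_one_pow ⟨_, rfl⟩]
  · intro T f
    by_contra h
    obtain ⟨r, hr, -⟩ := halfD_ne h
    rw [hβF, (Finset.mem_filter.1 f.2).2.2] at hr
    simp at hr
  · intro c c'
    have hpiv : ∀ r ∈ OutS n k (σ c).1,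
        upS n k (σ c').1 {piv n k (σ c').1} = upS n k (σ c).1 {r} →
          c' = c ∧ r = piv n k (σ c).1 := by
      intro r hr h
      have hr' := Finset.singleton_subset_iff.2 hr
      have h1 := upper_spec (hl c').1 (hl c').2
      rw [h, up_piv (hl c).1 hr'] at h1
      rw [← h1.1] at h1
      have h2 := In_Out_disj (up_mem (hl c).1 hr') h1.2
      rw [up_Out (hl c).1 hr', Finset.mem_sdiff] at h2
      have h3 : piv n k (σ c).1 = r := by
        by_contra h3
        exact h2 ⟨(hl c).2, by simpa using h3⟩
      rw [← h3] at h
      refine ⟨?_, h3.symm⟩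
      exact σ.injective (Subtype.ext (upper_inj (hl c').1 (hl c').2 (hl c).1 (hl c).2 h))
    simp only [halfD]
    rw [hβ1, hβ0]
    split_ifs with hc
    · subst hc
      rw [Finset.sum_eq_single (piv n k (σ c').1)]
      · rw [if_pos rfl]
      · intro r hr hne
        rw [if_neg]
        intro h
        exact hne (hpiv r hr h).2
      · intro h; exact absurd (hl c').2 h
    · apply Finset.sum_eq_zero
      intro r hr
      rw [if_neg]
      intro h
      exact hc (hpiv r hr h).1
  · intro c
    rw [hu1, hβ0]
  · rintro (x | ⟨x, i⟩) (y | ⟨y, j⟩)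
    · rfl
    · rfl
    · rfl
    · simp only [coneSumD13]
      congr
  · rintro (f | ⟨c, i⟩)
    · rfl
    · obtain rfl | rfl : i = 0 ∨ i = 1 := by omega
      · have := hσ c
        simp only [Sum.elim_inr, hβ0, Fin.val_zero]
        omega
      · have := hσ c
        simp only [Sum.elim_inr, hu1, Fin.val_one]
        omega
end

section
/- Let 0 ≤ k ≤ n be integers and S ∈ {n;k}. For every Θ in the boundary ∂([0,π]^{Z_S}) := [0,π]^{Z_S} ∖ (0,π)^{Z_S}, the point Rot_S(Θ) lies in the union ⋃_{T < S} Gr_k(ℝ^n)_T of the Schubert cells indexed by elements T strictly below S in the componentwise order (s_i ≤ t_i for all i) on {n;k}; equivalently, the restriction of Rot_S to the boundary of the cube factors through this union. -/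
open scoped BigOperators

/-- The componentwise partial order on `{n;k}`: `T ≤ S` iff `t_i ≤ s_i` for all `i`. -/
def ole (k : ℕ) (T S : Finset ℕ) : Prop := ∀ i ∈ Finset.Icc 1 k, elt T i ≤ elt S i

/-- `ℝ^S ⊆ ℝ^n`: the span of the standard basis vectors `e_i`, `i ∈ S`
(coordinates labelled `1,…,n`). -/
def RS (n : ℕ) (S : Finset ℕ) : Submodule ℝ (Fin n → ℝ) :=
  Submodule.span ℝ {v | ∃ i : Fin n, (i : ℕ) + 1 ∈ S ∧ v = Pi.single i (1 : ℝ)}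

/-- The orthogonal projection `pr_S : ℝ^n → ℝ^S` (as an endomorphism of `ℝ^n`). -/
noncomputable def prS (n : ℕ) (S : Finset ℕ) : (Fin n → ℝ) →ₗ[ℝ] (Fin n → ℝ) :=
  LinearMap.pi fun i => if (i : ℕ) + 1 ∈ S then LinearMap.proj i else 0

/-- The condition that `pr_S` restricts to an isomorphism `W → ℝ^S`, i.e. `W ∈ U_S`. -/
def USpred (n : ℕ) (S : Finset ℕ) (W : Submodule ℝ (Fin n → ℝ)) : Prop :=
  ∀ y ∈ RS n S, ∃! x, x ∈ W ∧ prS n S x = y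

/-- `W` lies in the Schubert cell of `S`: `W` is a `k`-dimensional subspace, `W ∈ U_S`, and `S`
is the maximal element of `{n;k}` with `W ∈ U_S` (w.r.t. the componentwise order). -/
def cellPred (n k : ℕ) (S : Finset ℕ) (W : Submodule ℝ (Fin n → ℝ)) : Prop :=
  Module.finrank ℝ W = k ∧ USpred n S W ∧ ∀ T ∈ Sset n k, USpred n T W → ole k T S

/-- `R_j(θ)`: the `n×n` rotation by angle `θ` of the oriented `(j, j+1)`-coordinate plane of
`ℝ^n` (coordinates labelled `1,…,n`), the identity on all other coordinates. -/
noncomputable def Rmat (n : ℕ) (j : ℕ) (θ : ℝ) : Matrix (Fin n) (Fin n) ℝ :=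
  fun a b =>
    if (a : ℕ) + 1 = j ∧ (b : ℕ) + 1 = j then Real.cos θ
    else if (a : ℕ) + 1 = j ∧ (b : ℕ) = j then -Real.sin θ
    else if (a : ℕ) = j ∧ (b : ℕ) + 1 = j then Real.sin θ
    else if (a : ℕ) = j ∧ (b : ℕ) = j then Real.cos θ
    else if a = b then 1 else 0

/-- `Z_S = {(i,j) : 1 ≤ i ≤ k, i ≤ j ≤ s_i − 1}` as a list, enumerated in its total order:
`(i,j) ≤ (i′,j′)` iff `i < i′`, or `i = i′` and `j ≥ j′`. -/
def ZS (S : Finset ℕ) (k : ℕ) : List (ℕ × ℕ) :=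
  (List.range k).flatMap fun i' =>
    (List.range (elt S (i' + 1) - (i' + 1))).map fun t => (i' + 1, elt S (i' + 1) - 1 - t)

/-- The first `k` columns of the `n×n` identity matrix. -/
def onesNK (n k : ℕ) : Matrix (Fin n) (Fin k) ℝ :=
  fun a b => if (a : ℕ) = (b : ℕ) then 1 else 0

/-- The product `(Π_{(i,j) ∈ Z_S} R_j(θ_{(i,j)})) · 1_{n×k}`, taken in the total order of `Z_S`. -/
noncomputable def rotMat (n k : ℕ) (S : Finset ℕ) (Θ : ℕ × ℕ → ℝ) :
    Matrix (Fin n) (Fin k) ℝ :=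
  ((ZS S k).map fun p => Rmat n p.2 (Θ p)).prod * onesNK n k

/-- The column space of an `n×k` matrix. -/
def colSpan (n k : ℕ) (A : Matrix (Fin n) (Fin k) ℝ) : Submodule ℝ (Fin n → ℝ) :=
  Submodule.span ℝ (Set.range fun j : Fin k => fun i : Fin n => A i j)

/-- The coordinate flag: vectors supported on the first `m` coordinates. -/
def FF (n m : ℕ) : Submodule ℝ (Fin n → ℝ) where
  carrier := {v | ∀ a : Fin n, m ≤ (a : ℕ) → v a = 0}
  add_mem' := by
    intro u v hu hv a ha
    simp [hu a ha, hv a ha]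
  zero_mem' := by intro a _; rfl
  smul_mem' := by
    intro c v hv a ha
    simp [hv a ha]

lemma mem_FF {n m : ℕ} {v : Fin n → ℝ} :
    v ∈ FF n m ↔ ∀ a : Fin n, m ≤ (a : ℕ) → v a = 0 := Iff.rfl

lemma FF_mono {n m m' : ℕ} (h : m ≤ m') : FF n m ≤ FF n m' :=
  fun _ hv a ha => hv a (h.trans ha)

lemma elt_eq {T : Finset ℕ} {k i : ℕ} (hT : T.card = k) (hi : i < k) :
    elt T (i + 1) = T.orderEmbOfFin hT ⟨i, hi⟩ := by
  rw [Finset.orderEmbOfFin_apply]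
  unfold elt
  simp [hT, hi]

lemma elt_lt {T : Finset ℕ} {k i j : ℕ} (hT : T.card = k) (hij : i < j) (hj : j < k) :
    elt T (i + 1) < elt T (j + 1) := by
  rw [elt_eq hT (hij.trans hj), elt_eq hT hj]
  exact (T.orderEmbOfFin hT).strictMono hij

lemma elt_mem {T : Finset ℕ} {k i : ℕ} (hT : T.card = k) (hi : i < k) : elt T (i + 1) ∈ T := by
  rw [elt_eq hT hi]; exact Finset.orderEmbOfFin_mem _ _ _

lemma elt_le_iff {T : Finset ℕ} {k i m : ℕ} (hT : T.card = k) (hi : i < k) :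
    elt T (i + 1) ≤ m ↔ i + 1 ≤ (T.filter (· ≤ m)).card := by
  rw [elt_eq hT hi]
  set f := T.orderEmbOfFin hT with hf
  have hc : T.filter (· ≤ m) = (Finset.univ.filter (fun j : Fin k => f j ≤ m)).map f.toEmbedding := by
    ext x
    simp only [Finset.mem_filter, Finset.mem_map, Finset.mem_univ, true_and]
    constructor
    · rintro ⟨hx, hm⟩
      have : x ∈ Set.range f := by rw [hf, Finset.range_orderEmbOfFin]; exact hx
      obtain ⟨j, rfl⟩ := this
      exact ⟨j, hm, rfl⟩
    · rintro ⟨j, hj, rfl⟩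
      exact ⟨Finset.orderEmbOfFin_mem _ _ _, hj⟩
  rw [hc, Finset.card_map]
  constructor
  · intro h
    have : Finset.Iic (⟨i, hi⟩ : Fin k) ⊆ Finset.univ.filter (fun j : Fin k => f j ≤ m) := by
      intro j hj
      simp only [Finset.mem_filter, Finset.mem_univ, true_and]
      exact (f.monotone (Finset.mem_Iic.1 hj)).trans h
    simpa using Finset.card_le_card this
  · intro h
    by_contra hlt
    have : Finset.univ.filter (fun j : Fin k => f j ≤ m) ⊆ Finset.Iio (⟨i, hi⟩ : Fin k) := by
      intro j hj
      simp only [Finset.mem_filter, Finset.mem_univ, true_and] at hj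
      rw [Finset.mem_Iio]
      by_contra hji
      exact hlt ((f.monotone (not_lt.1 hji)).trans hj)
    have := Finset.card_le_card this
    simp at this
    omega

/-- Coordinates in `T`. -/
def resT (n : ℕ) (T : Finset ℕ) : (Fin n → ℝ) →ₗ[ℝ] ({a : Fin n // (a : ℕ) + 1 ∈ T} → ℝ) :=
  LinearMap.funLeft ℝ ℝ Subtype.val

lemma card_sub_le (n : ℕ) (T : Finset ℕ) :
    Fintype.card {a : Fin n // (a : ℕ) + 1 ∈ T} ≤ T.card := by
  rw [← Fintype.card_coe]
  refine Fintype.card_le_of_injective (fun a => ⟨(a.1 : ℕ) + 1, a.2⟩) ?_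
  intro a b h
  simp only [Subtype.mk.injEq] at h
  exact Subtype.ext (Fin.ext (by omega))

lemma finrank_le_of_inj {n : ℕ} {T : Finset ℕ} {A : Submodule ℝ (Fin n → ℝ)}
    (h : ∀ w ∈ A, (∀ a : Fin n, (a : ℕ) + 1 ∈ T → w a = 0) → w = 0) :
    Module.finrank ℝ A ≤ Fintype.card {a : Fin n // (a : ℕ) + 1 ∈ T} ∧
    Function.Injective ((resT n T).comp A.subtype) := by
  have hi : Function.Injective ((resT n T).comp A.subtype) := by
    rw [injective_iff_map_eq_zero]
    intro w hw
    apply Subtype.ext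
    refine h w w.2 ?_
    intro a ha
    exact congrFun hw ⟨a, ha⟩
  refine ⟨?_, hi⟩
  have := LinearMap.finrank_le_finrank_of_injective hi
  simpa using this

lemma prS_apply (n : ℕ) (S : Finset ℕ) (x : Fin n → ℝ) (a : Fin n) :
    prS n S x a = if (a : ℕ) + 1 ∈ S then x a else 0 := by
  unfold prS
  rw [LinearMap.pi_apply]
  split_ifs <;> simp

lemma RS_zero {n : ℕ} {S : Finset ℕ} {y : Fin n → ℝ} (hy : y ∈ RS n S) (a : Fin n)
    (ha : (a : ℕ) + 1 ∉ S) : y a = 0 := by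
  have : RS n S ≤ LinearMap.ker (LinearMap.proj (R := ℝ) (φ := fun _ : Fin n => ℝ) a) := by
    unfold RS
    rw [Submodule.span_le]
    rintro v ⟨i, hi, rfl⟩
    simp only [SetLike.mem_coe, LinearMap.mem_ker, LinearMap.proj_apply]
    rw [Pi.single_apply, if_neg]
    rintro rfl
    exact ha hi
  exact this hy

lemma US_finrank {n : ℕ} {T : Finset ℕ} {W : Submodule ℝ (Fin n → ℝ)} (h : USpred n T W) (m : ℕ) :
    Module.finrank ℝ (W ⊓ FF n m : Submodule ℝ (Fin n → ℝ)) ≤ (T.filter (· ≤ m)).card := by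
  refine le_trans (finrank_le_of_inj (T := T.filter (· ≤ m)) ?_).1 (card_sub_le _ _)
  rintro w ⟨hw, hwm⟩ h0
  obtain ⟨x, -, hu⟩ := h 0 (Submodule.zero_mem _)
  have h1 := hu 0 ⟨W.zero_mem, by simp⟩
  have h2 := hu w ⟨hw, by
    ext a
    rw [prS_apply]
    split_ifs with ha
    · by_cases ham : m ≤ (a : ℕ)
      · exact hwm a ham
      · exact h0 a (by simp [ha]; omega)
    · rfl⟩
  rw [h2, h1]

open Classical in
/-- Jump set of `W`. -/
noncomputable def jump (n : ℕ) (W : Submodule ℝ (Fin n → ℝ)) : Finset ℕ :=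
  (Finset.Icc 1 n).filter fun t => ∃ w ∈ W, w ∈ FF n t ∧ w ∉ FF n (t - 1)

lemma jump_zero {n : ℕ} {W : Submodule ℝ (Fin n → ℝ)} (w : Fin n → ℝ) (hw : w ∈ W)
    (h : ∀ a : Fin n, (a : ℕ) + 1 ∈ jump n W → w a = 0) : w = 0 := by
  have key : ∀ d, d ≤ n → w ∈ FF n (n - d) := by
    intro d
    induction d with
    | zero => intro _ a ha; omega
    | succ d ih =>
      intro hd
      have h1 := ih (by omega)
      intro a ha
      by_cases hda : n - d ≤ (a : ℕ)
      · exact h1 a hda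
      by_contra hne
      apply hne
      apply h
      simp only [jump, Finset.mem_filter, Finset.mem_Icc]
      refine ⟨by omega, w, hw, ?_, ?_⟩
      · rwa [show (a : ℕ) + 1 = n - d by omega]
      · intro hc
        exact hne (hc a (by omega))
  ext a
  exact key n le_rfl a (by omega)

lemma jump_card {n : ℕ} (W : Submodule ℝ (Fin n → ℝ)) (m : ℕ) (hm : m ≤ n) :
    ((jump n W).filter (· ≤ m)).card =
      Module.finrank ℝ (W ⊓ FF n m : Submodule ℝ (Fin n → ℝ)) := by
  apply le_antisymm
  · induction m with
    | zero =>
      have : (jump n W).filter (· ≤ 0) = ∅ := by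
        ext x
        simp [jump]
        intro h; omega
      rw [this]; simp
    | succ m ih =>
      have ih := ih (by omega)
      by_cases hj : m + 1 ∈ jump n W
      · have h1 : (jump n W).filter (· ≤ m + 1) ⊆ insert (m + 1) ((jump n W).filter (· ≤ m)) := by
          intro x hx
          simp only [Finset.mem_filter, Finset.mem_insert] at hx ⊢
          by_cases x = m + 1
          · left; assumption
          · right; exact ⟨hx.1, by omega⟩
        have h2 := (Finset.card_le_card h1).trans (Finset.card_insert_le _ _)
        have h3 : W ⊓ FF n m < W ⊓ FF n (m + 1) := by
          refine lt_of_le_of_ne (inf_le_inf_left _ (FF_mono (by omega))) ?_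
          intro he
          simp only [jump, Finset.mem_filter] at hj
          obtain ⟨_, w, hw, hw1, hw2⟩ := hj
          have : w ∈ W ⊓ FF n m := by rw [he]; exact ⟨hw, hw1⟩
          exact hw2 this.2
        have := Submodule.finrank_lt_finrank_of_lt h3
        omega
      · have h1 : (jump n W).filter (· ≤ m + 1) = (jump n W).filter (· ≤ m) := by
          ext x
          simp only [Finset.mem_filter, and_congr_right_iff]
          intro hx
          have : x ≠ m + 1 := by rintro rfl; exact hj hx
          omega
        rw [h1]
        exact ih.trans (Submodule.finrank_mono (inf_le_inf_left _ (FF_mono (by omega))))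
  · refine le_trans (finrank_le_of_inj (T := (jump n W).filter (· ≤ m)) ?_).1 (card_sub_le _ _)
    rintro w ⟨hw, hwm⟩ h0
    apply jump_zero w hw
    intro a ha
    by_cases ham : m ≤ (a : ℕ)
    · exact hwm a ham
    · exact h0 a (by simp [ha]; omega)

lemma FF_top (n : ℕ) : FF n n = ⊤ := by
  rw [eq_top_iff]
  intro v _ a ha
  omega

lemma jump_sub {n : ℕ} (W : Submodule ℝ (Fin n → ℝ)) : jump n W ⊆ Finset.Icc 1 n := by
  intro x hx
  simp only [jump, Finset.mem_filter] at hx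
  exact hx.1

lemma jump_card' {n : ℕ} (W : Submodule ℝ (Fin n → ℝ)) :
    (jump n W).card = Module.finrank ℝ W := by
  have h := jump_card W n le_rfl
  rw [FF_top, inf_top_eq, Finset.filter_true_of_mem] at h
  · exact h
  · intro x hx
    exact (Finset.mem_Icc.1 (jump_sub W hx)).2

lemma jump_US {n : ℕ} (W : Submodule ℝ (Fin n → ℝ)) : USpred n (jump n W) W := by
  obtain ⟨hle, hinj⟩ := finrank_le_of_inj (T := jump n W) (A := W) (fun w hw h => jump_zero w hw h)
  have hle2 := card_sub_le n (jump n W)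
  rw [jump_card'] at hle2
  have hsurj : Function.Surjective ((resT n (jump n W)).comp W.subtype) := by
    refine (LinearMap.injective_iff_surjective_of_finrank_eq_finrank ?_).1 hinj
    simp only [Module.finrank_fintype_fun_eq_card]
    omega
  intro y hy
  obtain ⟨w, hw⟩ := hsurj (resT n _ y)
  have hwy : ∀ a : Fin n, (a : ℕ) + 1 ∈ jump n W → w.1 a = y a := fun a ha => congrFun hw ⟨a, ha⟩
  refine ⟨w, ⟨w.2, ?_⟩, ?_⟩
  · ext a
    rw [prS_apply]
    split_ifs with ha
    · exact hwy a ha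
    · exact (RS_zero hy a ha).symm
  · rintro x ⟨hx, hxy⟩
    rw [← sub_eq_zero]
    apply jump_zero _ (W.sub_mem hx w.2)
    intro a ha
    have := congrFun hxy a
    rw [prS_apply, if_pos ha] at this
    simp [hwy a ha, this]

lemma jump_cell {n k : ℕ} (W : Submodule ℝ (Fin n → ℝ)) (hW : Module.finrank ℝ W = k) :
    cellPred n k (jump n W) W := by
  refine ⟨hW, jump_US W, ?_⟩
  intro T hT hTW i hi
  have hTc := (Finset.mem_powersetCard.1 hT).2
  have hJc : (jump n W).card = k := by rw [jump_card', hW]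
  obtain ⟨h1, h2⟩ := Finset.mem_Icc.1 hi
  obtain ⟨i, rfl⟩ : ∃ i', i = i' + 1 := ⟨i - 1, by omega⟩
  rw [elt_le_iff hTc (by omega)]
  refine le_trans ?_ (US_finrank hTW _)
  rw [← jump_card W _ (Finset.mem_Icc.1 (jump_sub W (elt_mem hJc (by omega)))).2]
  rw [← elt_le_iff hJc (by omega)]

open Matrix

lemma Rmat_mulVec {n j : ℕ} (hj : 1 ≤ j) (hjn : j < n) (θ : ℝ) (v : Fin n → ℝ) (a : Fin n) :
    (Rmat n j θ *ᵥ v) a =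
      if (a : ℕ) + 1 = j then
        Real.cos θ * v ⟨j - 1, by omega⟩ - Real.sin θ * v ⟨j, hjn⟩
      else if (a : ℕ) = j then
        Real.sin θ * v ⟨j - 1, by omega⟩ + Real.cos θ * v ⟨j, hjn⟩
      else v a := by
  have hne : (⟨j - 1, by omega⟩ : Fin n) ≠ ⟨j, hjn⟩ := by simp; omega
  simp only [Matrix.mulVec, dotProduct]
  by_cases h1 : (a : ℕ) + 1 = j
  · rw [Fintype.sum_eq_add _ _ hne]
    · simp [Rmat, h1, show j - 1 + 1 = j by omega, show ¬ (j - 1 = j) by omega]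
      ring
    · rintro x ⟨hx1, hx2⟩
      have e1 : ¬ ((x : ℕ) + 1 = j) := fun h => hx1 (Fin.ext (by simp; omega))
      have e2 : ¬ ((x : ℕ) = j) := fun h => hx2 (Fin.ext (by simp; omega))
      have e3 : ¬ (a = x) := by rintro rfl; exact e1 h1
      simp [Rmat, e1, e2, e3]
  · by_cases h2 : (a : ℕ) = j
    · rw [Fintype.sum_eq_add _ _ hne]
      · simp [Rmat, h2, show j - 1 + 1 = j by omega]
      · rintro x ⟨hx1, hx2⟩
        have e1 : ¬ ((x : ℕ) + 1 = j) := fun h => hx1 (Fin.ext (by simp; omega))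
        have e2 : ¬ ((x : ℕ) = j) := fun h => hx2 (Fin.ext (by simp; omega))
        have e3 : ¬ (a = x) := by rintro rfl; exact e2 h2
        simp [Rmat, e1, e2, e3]
    · rw [Fintype.sum_eq_single a]
      · simp [Rmat, h1, h2]
      · intro x hx
        simp [Rmat, h1, h2, Ne.symm hx]

lemma Rmat_inj {n j : ℕ} (hj : 1 ≤ j) (hjn : j < n) (θ : ℝ) (v : Fin n → ℝ)
    (h : Rmat n j θ *ᵥ v = 0) : v = 0 := by
  have key : ∀ a, _ := fun a => (Rmat_mulVec hj hjn θ v a).symm.trans (congrFun h a)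
  have k1 := key ⟨j - 1, by omega⟩
  have k2 := key ⟨j, hjn⟩
  simp [show j - 1 + 1 = j by omega] at k1 k2
  have hcs := Real.sin_sq_add_cos_sq θ
  ext a
  by_cases h1 : (a : ℕ) + 1 = j
  · have : a = ⟨j - 1, by omega⟩ := Fin.ext (by simp; omega)
    rw [this]
    simp only [Pi.zero_apply]
    linear_combination Real.cos θ * k1 + Real.sin θ * k2 - v ⟨j - 1, by omega⟩ * hcs
  · by_cases h2 : (a : ℕ) = j
    · have : a = ⟨j, hjn⟩ := Fin.ext (by simp; omega)
      rw [this]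
      simp only [Pi.zero_apply]
      linear_combination Real.cos θ * k2 - Real.sin θ * k1 - v ⟨j, hjn⟩ * hcs
    · have := key a
      simpa [h1, h2] using this

/-- `R_j` fixes vectors supported strictly below. -/
lemma Rmat_fix {n j m : ℕ} (hj : 1 ≤ j) (hjn : j < n) (hm : m < j) (θ : ℝ) (v : Fin n → ℝ)
    (hv : v ∈ FF n m) : Rmat n j θ *ᵥ v = v := by
  have e1 : v ⟨j - 1, by omega⟩ = 0 := hv _ (by simp; omega)
  have e2 : v ⟨j, hjn⟩ = 0 := hv _ (by simp; omega)
  ext a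
  rw [Rmat_mulVec hj hjn, e1, e2]
  split_ifs with h1 h2
  · rw [hv a (by omega)]; simp
  · rw [hv a (by omega)]; simp
  · rfl

lemma Rmat_pres {n j m : ℕ} (hj : 1 ≤ j) (hjn : j < n) (hm : j + 1 ≤ m) (θ : ℝ) (v : Fin n → ℝ)
    (hv : v ∈ FF n m) : Rmat n j θ *ᵥ v ∈ FF n m := by
  intro a ha
  rw [Rmat_mulVec hj hjn, if_neg (by omega), if_neg (by omega)]
  exact hv a ha

lemma Rmat_sin {n j : ℕ} (hj : 1 ≤ j) (hjn : j < n) (θ : ℝ) (hθ : Real.sin θ = 0)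
    (v : Fin n → ℝ) (hv : v ∈ FF n j) : Rmat n j θ *ᵥ v ∈ FF n j := by
  intro a ha
  rw [Rmat_mulVec hj hjn, if_neg (by omega)]
  split_ifs with h
  · rw [hθ, hv ⟨j, hjn⟩ le_rfl]; simp
  · exact hv a ha

/-- product of rotations over a list -/
noncomputable def LP (n : ℕ) (Θ : ℕ × ℕ → ℝ) (l : List (ℕ × ℕ)) : Matrix (Fin n) (Fin n) ℝ :=
  (l.map fun p => Rmat n p.2 (Θ p)).prod

lemma LP_cons (n : ℕ) (Θ : ℕ × ℕ → ℝ) (p : ℕ × ℕ) (l : List (ℕ × ℕ)) (v : Fin n → ℝ) :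
    LP n Θ (p :: l) *ᵥ v = Rmat n p.2 (Θ p) *ᵥ (LP n Θ l *ᵥ v) := by
  simp [LP, Matrix.mulVec_mulVec]

lemma LP_append (n : ℕ) (Θ : ℕ × ℕ → ℝ) (l l' : List (ℕ × ℕ)) (v : Fin n → ℝ) :
    LP n Θ (l ++ l') *ᵥ v = LP n Θ l *ᵥ (LP n Θ l' *ᵥ v) := by
  simp [LP, Matrix.mulVec_mulVec]

lemma LP_inj {n : ℕ} (Θ : ℕ × ℕ → ℝ) (l : List (ℕ × ℕ)) (hl : ∀ p ∈ l, 1 ≤ p.2 ∧ p.2 < n)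
    (v : Fin n → ℝ) (h : LP n Θ l *ᵥ v = 0) : v = 0 := by
  induction l with
  | nil => simpa [LP] using h
  | cons p l ih =>
    rw [LP_cons] at h
    have hp := hl p (by simp)
    exact ih (fun q hq => hl q (by simp [hq])) (Rmat_inj hp.1 hp.2 _ _ h)

lemma LP_fix {n m : ℕ} (Θ : ℕ × ℕ → ℝ) (l : List (ℕ × ℕ)) (hl : ∀ p ∈ l, m < p.2 ∧ p.2 < n)
    (v : Fin n → ℝ) (hv : v ∈ FF n m) : LP n Θ l *ᵥ v = v := by
  induction l with
  | nil => simp [LP]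
  | cons p l ih =>
    have hp := hl p (by simp)
    rw [LP_cons, ih (fun q hq => hl q (by simp [hq])), Rmat_fix (by omega) hp.2 hp.1 _ _ hv]

lemma LP_pres {n m : ℕ} (Θ : ℕ × ℕ → ℝ) (l : List (ℕ × ℕ))
    (hl : ∀ p ∈ l, 1 ≤ p.2 ∧ p.2 < n ∧ p.2 + 1 ≤ m)
    (v : Fin n → ℝ) (hv : v ∈ FF n m) : LP n Θ l *ᵥ v ∈ FF n m := by
  induction l with
  | nil => simpa [LP] using hv
  | cons p l ih =>
    have hp := hl p (by simp)
    rw [LP_cons]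
    exact Rmat_pres hp.1 hp.2.1 hp.2.2 _ _ (ih (fun q hq => hl q (by simp [hq])))

lemma LP_block {n : ℕ} (Θ : ℕ × ℕ → ℝ) (c L : ℕ) (hL : c + L < n) (v : Fin n → ℝ)
    (hv : v ∈ FF n (c + 1)) :
    LP n Θ ((List.range L).map fun t => (c + 1, c + L - t)) *ᵥ v ∈ FF n (c + 1 + L) ∧
    ((∃ p ∈ (List.range L).map (fun t => (c + 1, c + L - t)), Real.sin (Θ p) = 0) →
      LP n Θ ((List.range L).map fun t => (c + 1, c + L - t)) *ᵥ v ∈ FF n (c + L)) := by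
  induction L with
  | zero => simpa [LP] using hv
  | succ L ih =>
    obtain ⟨ih1, ih2⟩ := ih (by omega)
    have hl : (List.range (L + 1)).map (fun t => (c + 1, c + (L + 1) - t)) =
        (c + 1, c + L + 1) :: (List.range L).map (fun t => (c + 1, c + L - t)) := by
      rw [List.range_succ_eq_map, List.map_cons, List.map_map]
      congr 1
      apply List.map_congr_left
      intro t _
      simp
      omega
    rw [hl]
    rw [LP_cons]
    refine ⟨?_, ?_⟩
    · exact Rmat_pres (by simp) (by simp; omega) (by simp; omega) _ _ (FF_mono (by omega) ih1)
    · rintro ⟨p, hp, hs⟩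
      rw [List.mem_cons] at hp
      rcases hp with rfl | hp
      · rw [show c + 1 + L = c + L + 1 by omega] at ih1
        exact Rmat_sin (j := c + L + 1) (by omega) (by omega) _ hs _ ih1
      · have h := ih2 ⟨p, hp, hs⟩
        rw [Rmat_fix (by simp) (by simp; omega) (by simp) _ _ h]
        exact FF_mono (by omega) h

/-- The `i`-th block of `Z_S`. -/
def blk (S : Finset ℕ) (i' : ℕ) : List (ℕ × ℕ) :=
  (List.range (elt S (i' + 1) - (i' + 1))).map fun t => (i' + 1, elt S (i' + 1) - 1 - t)

lemma mem_blk {S : Finset ℕ} {i : ℕ} {p : ℕ × ℕ} (h : p ∈ blk S i) :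
    p.1 = i + 1 ∧ i + 1 ≤ p.2 ∧ p.2 + 1 ≤ elt S (i + 1) := by
  simp only [blk, List.mem_map, List.mem_range] at h
  obtain ⟨t, ht, rfl⟩ := h
  refine ⟨rfl, ?_, ?_⟩ <;> simp <;> omega

lemma le_elt {n k i : ℕ} {S : Finset ℕ} (hS : S ∈ Sset n k) (hi : i < k) :
    i + 1 ≤ elt S (i + 1) := by
  obtain ⟨h1, h2⟩ := Finset.mem_powersetCard.1 hS
  induction i with
  | zero => exact (Finset.mem_Icc.1 (h1 (elt_mem h2 hi))).1
  | succ i ih =>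
    have := ih (by omega)
    have := elt_lt h2 (Nat.lt_succ_self i) hi
    simp only [Nat.succ_eq_add_one] at this
    omega

lemma elt_le_n {n k i : ℕ} {S : Finset ℕ} (hS : S ∈ Sset n k) (hi : i < k) :
    elt S (i + 1) ≤ n := by
  obtain ⟨h1, h2⟩ := Finset.mem_powersetCard.1 hS
  exact (Finset.mem_Icc.1 (h1 (elt_mem h2 hi))).2

lemma ZS_split (S : Finset ℕ) {k c : ℕ} (hc : c < k) :
    ZS S k = (List.range c).flatMap (blk S) ++ (blk S c ++
      ((List.range (k - (c + 1))).map (fun t => c + 1 + t)).flatMap (blk S)) := by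
  have : List.range k = List.range c ++ (c :: (List.range (k - (c + 1))).map (fun t => c + 1 + t)) := by
    conv_lhs => rw [show k = (c + 1) + (k - (c + 1)) by omega, List.range_add, List.range_succ]
    simp
  change (List.range k).flatMap (blk S) = _
  rw [this, List.flatMap_append, List.flatMap_cons]

lemma col_mem {n k c : ℕ} {S : Finset ℕ} (hS : S ∈ Sset n k) (hc : c < k) (Θ : ℕ × ℕ → ℝ)
    (v : Fin n → ℝ) (hv : v ∈ FF n (c + 1)) :
    LP n Θ (ZS S k) *ᵥ v ∈ FF n (elt S (c + 1)) ∧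
    ((∃ p ∈ blk S c, Real.sin (Θ p) = 0) →
      LP n Θ (ZS S k) *ᵥ v ∈ FF n (elt S (c + 1) - 1)) := by
  have hcard := (Finset.mem_powersetCard.1 hS).2
  have hle := le_elt hS hc
  have hn := elt_le_n hS hc
  rw [ZS_split S hc, LP_append, LP_append]
  rw [LP_fix (m := c + 1) Θ _ _ v hv]
  · have hb : blk S c = (List.range (elt S (c + 1) - (c + 1))).map
        fun t => (c + 1, c + (elt S (c + 1) - (c + 1)) - t) := by
      unfold blk
      rw [show elt S (c + 1) - 1 = c + (elt S (c + 1) - (c + 1)) by omega]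
    obtain ⟨b1, b2⟩ := LP_block Θ c (elt S (c + 1) - (c + 1)) (by omega) v hv
    rw [← hb] at b1 b2
    rw [show c + 1 + (elt S (c + 1) - (c + 1)) = elt S (c + 1) by omega] at b1
    rw [show c + (elt S (c + 1) - (c + 1)) = elt S (c + 1) - 1 by omega] at b2
    have hpre : ∀ p ∈ (List.range c).flatMap (blk S),
        1 ≤ p.2 ∧ p.2 < n ∧ p.2 + 1 ≤ elt S (c + 1) - 1 := by
      intro p hp
      simp only [List.mem_flatMap, List.mem_range] at hp
      obtain ⟨i, hi, hp⟩ := hp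
      have := mem_blk hp
      have := elt_lt hcard hi hc
      omega
    refine ⟨LP_pres Θ _ (fun p hp => ?_) _ b1, fun h => LP_pres Θ _ hpre _ (b2 h)⟩
    have := hpre p hp
    omega
  · intro p hp
    simp only [List.mem_flatMap, List.mem_map, List.mem_range] at hp
    obtain ⟨i, ⟨t, ht, rfl⟩, hp⟩ := hp
    have := mem_blk hp
    have := elt_le_n hS (i := c + 1 + t) (by omega)
    omega

/-- for every `Θ` in the boundary `[0,π]^{Z_S} ∖ (0,π)^{Z_S}` of the cube, the
plane `Rot_S(Θ)` lies in the union of the Schubert cells indexed by elements `T` strictly below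
`S` in the componentwise order on `{n;k}`. -/
theorem stmt16 (n k : ℕ) (hk : k ≤ n) (S : Finset ℕ) (hS : S ∈ Sset n k)
    (Θ : ℕ × ℕ → ℝ)
    (hbd : ∀ p ∈ ZS S k, Θ p ∈ Set.Icc 0 Real.pi)
    (hnotint : ∃ p ∈ ZS S k, Θ p = 0 ∨ Θ p = Real.pi) :
    ∃ T ∈ Sset n k, T ≠ S ∧ ole k T S ∧
      cellPred n k T (colSpan n k (rotMat n k S Θ)) := by
  have hcard := (Finset.mem_powersetCard.1 hS).2
  set W := colSpan n k (rotMat n k S Θ) with hWdef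
  let e : Fin k → Fin n → ℝ := fun j => Pi.single (Fin.castLE hk j) 1
  let col : Fin k → Fin n → ℝ := fun j => LP n Θ (ZS S k) *ᵥ e j
  have hcol : (fun j : Fin k => fun i : Fin n => rotMat n k S Θ i j) = col := by
    funext j i
    simp only [rotMat, Matrix.mul_apply, col, Matrix.mulVec, dotProduct, LP]
    apply Finset.sum_congr rfl
    intro x _
    congr 1
    simp only [onesNK, e, Pi.single_apply, Fin.ext_iff, Fin.val_castLE]
  have hW : W = Submodule.span ℝ (Set.range col) := by
    rw [hWdef, colSpan, hcol]
  have hmem : ∀ p ∈ ZS S k, ∃ i < k, p ∈ blk S i := by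
    intro p hp
    change p ∈ (List.range k).flatMap (blk S) at hp
    simpa [List.mem_flatMap] using hp
  have hli : LinearIndependent ℝ col := by
    have he : LinearIndependent ℝ e := by
      have := (Pi.basisFun ℝ (Fin n)).linearIndependent.comp (Fin.castLE hk)
        (Fin.castLE_injective hk)
      convert this using 1
      funext j
      simp [e]
    refine he.map' (LP n Θ (ZS S k)).mulVecLin ?_
    rw [LinearMap.ker_eq_bot']
    intro v hv
    refine LP_inj Θ (ZS S k) ?_ v hv
    intro p hp
    obtain ⟨i, hi, hp⟩ := hmem p hp
    have := mem_blk hp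
    have := elt_le_n hS hi
    omega
  have hfr : Module.finrank ℝ W = k := by
    rw [hW, finrank_span_eq_card hli, Fintype.card_fin]
  have hJc : (jump n W).card = k := by rw [jump_card', hfr]
  have heF : ∀ j : Fin k, e j ∈ FF n (j + 1) := by
    intro j a ha
    simp only [e, Pi.single_apply, Fin.ext_iff, Fin.val_castLE]
    rw [if_neg (by omega)]
  have hbound : ∀ i < k, ∀ m ≤ n, (∀ j : Fin k, (j : ℕ) ≤ i → col j ∈ FF n m) →
      elt (jump n W) (i + 1) ≤ m := by
    intro i hi m hm h
    rw [elt_le_iff hJc hi, jump_card W m hm]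
    have hli' := hli.comp (Fin.castLE (show i + 1 ≤ k by omega)) (Fin.castLE_injective _)
    have h1 := finrank_span_eq_card hli'
    rw [Fintype.card_fin] at h1
    rw [← h1]
    apply Submodule.finrank_mono
    rw [Submodule.span_le]
    rintro _ ⟨j, rfl⟩
    refine ⟨?_, h _ (by simp; omega)⟩
    rw [hW]
    exact Submodule.subset_span ⟨_, rfl⟩
  have hmono : ∀ i < k, ∀ j < i, elt S (j + 1) < elt S (i + 1) := fun i hi j hj =>
    elt_lt hcard hj hi
  refine ⟨jump n W, Finset.mem_powersetCard.2 ⟨jump_sub W, hJc⟩, ?_, ?_, jump_cell W hfr⟩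
  · obtain ⟨p, hp, hp0⟩ := hnotint
    obtain ⟨i, hi, hpi⟩ := hmem p hp
    have hs : Real.sin (Θ p) = 0 := by rcases hp0 with h | h <;> simp [h]
    have h1 := le_elt hS hi
    have h2 := elt_le_n hS hi
    have hb := hbound i hi (elt S (i + 1) - 1) (by omega) (by
      intro j hj
      rcases hj.lt_or_eq with hlt | heq
      · exact FF_mono (by have := hmono i hi j hlt; omega) (col_mem hS j.2 Θ _ (heF j)).1
      · have := (col_mem hS j.2 Θ _ (heF j)).2
        rw [heq] at this
        exact this ⟨p, hpi, hs⟩)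
    intro heq
    rw [heq] at hb
    omega
  · intro i hi
    obtain ⟨h1, h2⟩ := Finset.mem_Icc.1 hi
    obtain ⟨i, rfl⟩ : ∃ i', i = i' + 1 := ⟨i - 1, by omega⟩
    refine hbound i (by omega) _ (elt_le_n hS (by omega)) ?_
    intro j hj
    refine FF_mono ?_ (col_mem hS j.2 Θ _ (heF j)).1
    rcases hj.lt_or_eq with hlt | heq
    · exact (hmono i (by omega) j hlt).le
    · rw [heq]
end
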